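/- arXiv:1401.7704 — 3 statements merged into one kernel-verified Lean document; each statement's English description precedes it below -/
import Mathlib

section
/- Let J be a bounded whole-line Jacobi matrix that is reflectionless on (−2,2), with coefficients a_n, b_n. Then a_n ≥ 1 for all n ∈ ℤ. Moreover, if a_{n_0} = 1 for a single n_0 ∈ ℤ, then J is the free Jacobi matrix: a_n ≡ 1 and b_n ≡ 0. -/
open MeasureTheory Complex Filter Set

noncomputable section

/-- A Herglotz function: a holomorphic map from the open upper half plane to itself. -/
def IsHerglotz (m : ℂ → ℂ) : Prop :=
  DifferentiableOn ℂ m {z : ℂ | 0 < z.im} ∧ ∀ z : ℂ, 0 < z.im → 0 < (m z).im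

/-- `f` is a solution of the difference equation
`a_n f(n+1) + a_{n-1} f(n-1) + b_n f(n) = z f(n)` on `ℤ`. -/
def JacobiSolution (a b : ℤ → ℝ) (z : ℂ) (f : ℤ → ℂ) : Prop :=
  ∀ n : ℤ, (a n : ℂ) * f (n + 1) + (a (n - 1) : ℂ) * f (n - 1) + (b n : ℂ) * f n = z * f n

/-- `f : ℤ → ℂ` is square summable near `+∞`. -/
def SquareSummableAtTop (f : ℤ → ℂ) : Prop := Summable fun n : ℕ => ‖f (n : ℤ)‖ ^ 2

/-- `f : ℤ → ℂ` is square summable near `-∞`. -/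
def SquareSummableAtBot (f : ℤ → ℂ) : Prop := Summable fun n : ℕ => ‖f (-(n : ℤ))‖ ^ 2

/-- `m` is the half-line `m`-function `m₊` of the whole-line Jacobi matrix with
coefficients `a, b`: `m₊(z) = -f₊(1,z)/(a₀ f₊(0,z))`, where `f₊(·,z)` is a nontrivial
solution that is square summable near `+∞`. -/
def IsJacobiMPlus (a b : ℤ → ℝ) (m : ℂ → ℂ) : Prop :=
  ∀ z : ℂ, 0 < z.im → ∃ f : ℤ → ℂ, JacobiSolution a b z f ∧ SquareSummableAtTop f ∧
    f 0 ≠ 0 ∧ m z = -(f 1 / ((a 0 : ℂ) * f 0))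

/-- `m` is the half-line `m`-function `m₋` of the whole-line Jacobi matrix with
coefficients `a, b`: `m₋(z) = f₋(1,z)/(a₀ f₋(0,z))`, where `f₋(·,z)` is a nontrivial
solution that is square summable near `-∞`. -/
def IsJacobiMMinus (a b : ℤ → ℝ) (m : ℂ → ℂ) : Prop :=
  ∀ z : ℂ, 0 < z.im → ∃ f : ℤ → ℂ, JacobiSolution a b z f ∧ SquareSummableAtBot f ∧
    f 0 ≠ 0 ∧ m z = f 1 / ((a 0 : ℂ) * f 0)

/-- The pair `(m₊, m₋)` is reflectionless on `(-2,2)`: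
`m₊(x) = -conj(m₋(x))` for Lebesgue-a.e. `x ∈ (-2,2)` (boundary values). -/
def ReflectionlessOn22 (mp mm : ℂ → ℂ) : Prop :=
  ∀ᵐ x : ℝ, x ∈ Set.Ioo (-2:ℝ) 2 →
    Tendsto (fun y : ℝ => mp (↑x + ↑y * I) + starRingEnd ℂ (mm (↑x + ↑y * I)))
      (nhdsWithin 0 (Set.Ioi 0)) (nhds 0)

/-- The whole-line Jacobi matrix with coefficients `a, b` is reflectionless on `(-2,2)`. -/
def JacobiReflectionless (a b : ℤ → ℝ) : Prop :=
  ∃ mp mm : ℂ → ℂ, IsJacobiMPlus a b mp ∧ IsJacobiMMinus a b mm ∧ ReflectionlessOn22 mp mm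

/-- `T` is the bounded operator on `ℓ²(ℤ)` given by the Jacobi matrix with
coefficients `a, b`: `(Tu)_n = a_n u_{n+1} + a_{n-1} u_{n-1} + b_n u_n`. -/
def IsJacobiOperator (a b : ℤ → ℝ)
    (T : lp (fun _ : ℤ => ℂ) 2 →L[ℂ] lp (fun _ : ℤ => ℂ) 2) : Prop :=
  ∀ u : lp (fun _ : ℤ => ℂ) 2, ∀ n : ℤ,
    T u n = (a n : ℂ) * u (n + 1) + (a (n - 1) : ℂ) * u (n - 1) + (b n : ℂ) * u n

/-- `J ∈ M_R`: the whole-line Jacobi matrix with coefficients `a, b` (with `a_n > 0`)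
defines a bounded operator of norm `≤ R` and is reflectionless on `(-2,2)`. -/
def MemMR (R : ℝ) (a b : ℤ → ℝ) : Prop :=
  (∀ n : ℤ, 0 < a n) ∧
  (∃ T : lp (fun _ : ℤ => ℂ) 2 →L[ℂ] lp (fun _ : ℤ => ℂ) 2,
    IsJacobiOperator a b T ∧ ‖T‖ ≤ R) ∧
  JacobiReflectionless a b

/-- The domain `Ω = ℂ⁺ ∪ (-2,2) ∪ ℂ⁻`. -/
def Omega22 : Set ℂ := {z : ℂ | z.im ≠ 0 ∨ (-2 < z.re ∧ z.re < 2)}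

/-- `F` is the `F` function of the Jacobi matrix with coefficients `a, b`, reflectionless on
`(-2,2)`: `F(λ) = M(-λ - 1/λ)` on `ℂ⁺`, where `M : Ω → ℂ⁺` is the holomorphic continuation
of `m₊` to `Ω = ℂ⁺ ∪ (-2,2) ∪ ℂ⁻`. -/
def IsFFunction (a b : ℤ → ℝ) (F : ℂ → ℂ) : Prop :=
  ∃ mp M : ℂ → ℂ, IsJacobiMPlus a b mp ∧
    DifferentiableOn ℂ M Omega22 ∧
    (∀ z ∈ Omega22, 0 < (M z).im) ∧
    (∀ z : ℂ, 0 < z.im → M z = mp z) ∧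
    (∀ l : ℂ, 0 < l.im → F l = M (-l - 1/l))

/-! ### Complex analysis -/

lemma conj_dist_lt {w p : ℂ} (hw : 0 < w.im) (hp : 0 < p.im) :
    ‖w - p‖ < ‖w - starRingEnd ℂ p‖ := by
  have h1 : ‖w - p‖ ^ 2 < ‖w - starRingEnd ℂ p‖ ^ 2 := by
    rw [← Complex.normSq_eq_norm_sq, ← Complex.normSq_eq_norm_sq, Complex.normSq_apply,
      Complex.normSq_apply]
    simp
    nlinarith [mul_pos hw hp]
  exact lt_of_pow_lt_pow_left₀ 2 (norm_nonneg _) h1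

lemma sub_conj_ne {w p : ℂ} (hw : 0 < w.im) (hp : 0 < p.im) : w - starRingEnd ℂ p ≠ 0 := by
  intro h
  have := conj_dist_lt hw hp
  rw [h, norm_zero] at this
  exact absurd this (not_lt.mpr (norm_nonneg _))

lemma cayley_lt {w p : ℂ} (hw : 0 < w.im) (hp : 0 < p.im) :
    ‖(w - p) / (w - starRingEnd ℂ p)‖ < 1 := by
  rw [norm_div, div_lt_one (norm_pos_iff.mpr (sub_conj_ne hw hp))]
  exact conj_dist_lt hw hp

lemma one_sub_ne_of_norm_lt {ζ : ℂ} (h : ‖ζ‖ < 1) : 1 - ζ ≠ 0 := by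
  intro h0
  have : ζ = 1 := by linear_combination -h0
  rw [this] at h; simp at h

/-- Inverse Cayley transform maps the disc to the upper half plane. -/
lemma invCayley_im {ζ p : ℂ} (hp : 0 < p.im) (h : ‖ζ‖ < 1) :
    0 < ((p - starRingEnd ℂ p * ζ) / (1 - ζ)).im := by
  have h0 := one_sub_ne_of_norm_lt h
  have hn : 0 < Complex.normSq (1 - ζ) := Complex.normSq_pos.mpr h0
  have h2 : ζ.re * ζ.re + ζ.im * ζ.im < 1 := by
    rw [← Complex.normSq_apply, Complex.normSq_eq_norm_sq]
    nlinarith [norm_nonneg ζ]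
  have : ((p - starRingEnd ℂ p * ζ) / (1 - ζ)).im
      = p.im * (1 - (ζ.re * ζ.re + ζ.im * ζ.im)) / Complex.normSq (1 - ζ) := by
    rw [Complex.div_im]
    simp
    field_simp
    ring
  rw [this]
  apply div_pos _ hn
  apply mul_pos hp
  linarith

lemma pick_ineq {F : ℂ → ℂ} (hF : DifferentiableOn ℂ F {z : ℂ | 0 < z.im})
    (hpos : ∀ z : ℂ, 0 < z.im → 0 < (F z).im) {w p : ℂ} (hw : 0 < w.im) (hp : 0 < p.im) :
    Complex.normSq (F w - F p) * (w.im * p.im) ≤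
      Complex.normSq (w - p) * ((F w).im * (F p).im) := by
  set κ : ℂ → ℂ := fun ζ => (p - starRingEnd ℂ p * ζ) / (1 - ζ) with hκ
  set G : ℂ → ℂ := fun ζ => (F (κ ζ) - F p) / (F (κ ζ) - starRingEnd ℂ (F p)) with hG
  have hκm : ∀ ζ ∈ Metric.ball (0:ℂ) 1, 0 < (κ ζ).im := by
    intro ζ hζ
    exact invCayley_im hp (by simpa using hζ)
  have hκd : DifferentiableOn ℂ κ (Metric.ball 0 1) := by
    apply DifferentiableOn.div (by fun_prop) (by fun_prop)
    intro ζ hζ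
    exact one_sub_ne_of_norm_lt (by simpa using hζ)
  have hFκ : DifferentiableOn ℂ (fun ζ => F (κ ζ)) (Metric.ball 0 1) :=
    hF.comp hκd hκm
  have hGd : DifferentiableOn ℂ G (Metric.ball 0 1) := by
    apply DifferentiableOn.div (hFκ.sub_const _) (hFκ.sub_const _)
    intro ζ hζ
    exact sub_conj_ne (hpos _ (hκm ζ hζ)) (hpos _ hp)
  have hGm : MapsTo G (Metric.ball 0 1) (Metric.closedBall 0 1) := by
    intro ζ hζ
    have := cayley_lt (hpos _ (hκm ζ hζ)) (hpos _ hp)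
    simpa [hG] using this.le
  have hG0 : G 0 = 0 := by simp [hG, hκ]
  have hz := cayley_lt hw hp
  have hS := Complex.norm_le_norm_of_mapsTo_ball hGd hGm hG0 hz
  have hne := sub_conj_ne hw hp
  have hpp : p - starRingEnd ℂ p ≠ 0 := sub_conj_ne hp hp
  have hκw : κ ((w - p) / (w - starRingEnd ℂ p)) = w := by
    have h1 := one_sub_ne_of_norm_lt hz
    simp only [hκ]
    rw [div_eq_iff h1]
    field_simp
    ring
  simp only [hG] at hS
  rw [hκw, norm_div, norm_div] at hS
  have hne2 := sub_conj_ne (hpos _ hw) (hpos _ hp)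
  rw [div_le_div_iff₀ (norm_pos_iff.mpr hne2) (norm_pos_iff.mpr hne)] at hS
  have hS2 : (‖F w - F p‖ * ‖w - starRingEnd ℂ p‖) ^ 2 ≤
      (‖w - p‖ * ‖F w - starRingEnd ℂ (F p)‖) ^ 2 := by
    apply pow_le_pow_left₀ (by positivity) hS
  simp only [mul_pow, ← Complex.normSq_eq_norm_sq] at hS2
  have e : ∀ u v : ℂ, Complex.normSq (u - starRingEnd ℂ v) =
      Complex.normSq (u - v) + 4 * (u.im * v.im) := by
    intro u v
    simp [Complex.normSq_apply]
    ring
  rw [e, e] at hS2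
  nlinarith

/-- Primitives on the upper half plane. -/
lemma exists_primitive_uhp {φ : ℂ → ℂ} (hφ : DifferentiableOn ℂ φ {z : ℂ | 0 < z.im}) :
    ∃ Φ : ℂ → ℂ, ∀ z : ℂ, 0 < z.im → HasDerivAt Φ (φ z) z := by
  set κ : ℂ → ℂ := fun ζ => (I - starRingEnd ℂ I * ζ) / (1 - ζ) with hκ
  have hI : 0 < I.im := by simp
  have hκm : ∀ ζ ∈ Metric.ball (0:ℂ) 1, 0 < (κ ζ).im := by
    intro ζ hζ
    exact invCayley_im hI (by simpa using hζ)
  have hκd : DifferentiableOn ℂ κ (Metric.ball 0 1) := by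
    apply DifferentiableOn.div (by fun_prop) (by fun_prop)
    intro ζ hζ
    exact one_sub_ne_of_norm_lt (by simpa using hζ)
  have hd : DifferentiableOn ℂ (fun ζ => φ (κ ζ) * (2 * I / (1 - ζ) ^ 2)) (Metric.ball 0 1) := by
    apply DifferentiableOn.mul (hφ.comp hκd hκm)
    apply DifferentiableOn.div (by fun_prop) (by fun_prop)
    intro ζ hζ
    exact pow_ne_zero 2 (one_sub_ne_of_norm_lt (by simpa using hζ))
  obtain ⟨P, hP⟩ := hd.isExactOn_ball
  refine ⟨fun z => P ((z - I) / (z - starRingEnd ℂ I)), fun z hz => ?_⟩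
  have hz1 := cayley_lt hz hI
  have hne := sub_conj_ne hz hI
  have h1 := hP ((z - I) / (z - starRingEnd ℂ I)) (by simpa using hz1)
  have hκz : κ ((z - I) / (z - starRingEnd ℂ I)) = z := by
    have h1 := one_sub_ne_of_norm_lt hz1
    simp only [hκ]
    rw [div_eq_iff h1]
    field_simp
    ring
  have h2 : HasDerivAt (fun z => (z - I) / (z - starRingEnd ℂ I))
      ((1 * (z - starRingEnd ℂ I) - (z - I) * 1) / (z - starRingEnd ℂ I) ^ 2) z :=
    ((hasDerivAt_id z).sub_const I).div ((hasDerivAt_id z).sub_const _) hne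
  have h3 := h1.comp z h2
  refine h3.congr_deriv ?_
  beta_reduce
  rw [hκz]
  have h4 : 1 - (z - I) / (z - starRingEnd ℂ I) ≠ 0 := one_sub_ne_of_norm_lt hz1
  have h5 : 1 - (z - I) / (z - starRingEnd ℂ I) = 2 * I / (z - starRingEnd ℂ I) := by
    field_simp
    simp
    ring
  rw [h5]
  have := Complex.I_ne_zero
  simp only [Complex.conj_I] at hne ⊢
  field_simp
  ring_nf

open scoped Interval in
/-- Painlevé: a continuous function holomorphic off the real axis is holomorphic. -/
lemma painleve {H : ℂ → ℂ} {U : Set ℂ} (hU : IsOpen U) (hc : ContinuousOn H U)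
    (hd : ∀ z : ℂ, z.im ≠ 0 → DifferentiableAt ℂ H z) : DifferentiableOn ℂ H U := by
  refine (Complex.isConservativeOn_and_continuousOn_iff_isDifferentiableOn hU).1 ⟨?_, hc⟩
  intro z w hzw
  rw [← add_eq_zero_iff_eq_neg, Complex.wedgeIntegral_add_wedgeIntegral_eq]
  have hcR : ContinuousOn H ([[z.re, w.re]] ×ℂ [[z.im, w.im]]) := hc.mono hzw
  by_cases h0 : (0:ℝ) ∈ Ioo (min z.im w.im) (max z.im w.im)
  · have hm : (0:ℝ) ∈ [[z.im, w.im]] := Ioo_subset_Icc_self h0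
    have hs1 : [[z.im, (0:ℝ)]] ⊆ [[z.im, w.im]] := uIcc_subset_uIcc_left hm
    have hs2 : [[(0:ℝ), w.im]] ⊆ [[z.im, w.im]] := uIcc_subset_uIcc_right hm
    have hc1 : ContinuousOn H ([[z.re, w.re]] ×ℂ [[z.im, (0:ℝ)]]) :=
      hcR.mono (fun x hx => ⟨hx.1, hs1 hx.2⟩)
    have hc2 : ContinuousOn H ([[z.re, w.re]] ×ℂ [[(0:ℝ), w.im]]) :=
      hcR.mono (fun x hx => ⟨hx.1, hs2 hx.2⟩)
    have e1 := Complex.integral_boundary_rect_eq_zero_of_continuousOn_of_differentiableOn H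
      z (w.re : ℂ) (by simpa using hc1) (by
        intro x hx
        apply (hd x _).differentiableWithinAt
        intro h
        have := hx.2
        simp only [mem_preimage, Complex.ofReal_im, h, mem_Ioo] at this
        rcases this with ⟨h1, h2⟩
        rcases le_total z.im 0 with h3 | h3
        · rw [max_eq_right h3] at h2; exact lt_irrefl _ h2
        · rw [min_eq_right h3] at h1; exact lt_irrefl _ h1)
    have e2 := Complex.integral_boundary_rect_eq_zero_of_continuousOn_of_differentiableOn H
      (z.re : ℂ) w (by simpa using hc2) (by
        intro x hx
        apply (hd x _).differentiableWithinAt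
        intro h
        have := hx.2
        simp only [mem_preimage, Complex.ofReal_im, h, mem_Ioo] at this
        rcases this with ⟨h1, h2⟩
        rcases le_total w.im 0 with h3 | h3
        · rw [max_eq_left h3] at h2; exact lt_irrefl _ h2
        · rw [min_eq_left h3] at h1; exact lt_irrefl _ h1)
    have hv : ∀ x ∈ [[z.re, w.re]], ∀ s ⊆ [[z.im, w.im]],
        ContinuousOn (fun y : ℝ => H (x + y * I)) s := by
      intro x hx s hs
      apply hcR.comp (by fun_prop)
      intro y hy
      refine ⟨?_, ?_⟩
      · simpa using hx
      · simpa using hs hy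
    have i1 := intervalIntegral.integral_add_adjacent_intervals
      (hv w.re right_mem_uIcc _ hs1).intervalIntegrable
      (hv w.re right_mem_uIcc _ hs2).intervalIntegrable (μ := volume)
    have i2 := intervalIntegral.integral_add_adjacent_intervals
      (hv z.re left_mem_uIcc _ hs1).intervalIntegrable
      (hv z.re left_mem_uIcc _ hs2).intervalIntegrable (μ := volume)
    simp only [Complex.ofReal_re, Complex.ofReal_im, smul_eq_mul] at e1 e2 ⊢
    rw [← i1, ← i2]
    linear_combination e1 + e2
  · apply Complex.integral_boundary_rect_eq_zero_of_continuousOn_of_differentiableOn H z w hcR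
    intro x hx
    apply (hd x _).differentiableWithinAt
    intro h
    apply h0
    have := hx.2
    rw [mem_preimage, h] at this
    exact this

lemma isOpen_uhp : IsOpen {z : ℂ | 0 < z.im} := isOpen_lt continuous_const Complex.continuous_im

lemma isOpen_Omega22 : IsOpen Omega22 := by
  have h : Omega22 = {z : ℂ | z.im ≠ 0} ∪ ({z : ℂ | -2 < z.re} ∩ {z : ℂ | z.re < 2}) := by
    ext z; simp [Omega22]
  rw [h]
  apply IsOpen.union
  · exact isOpen_ne_fun Complex.continuous_im continuous_const
  · exact (isOpen_lt continuous_const Complex.continuous_re).inter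
      (isOpen_lt Complex.continuous_re continuous_const)

lemma exists_lip_primitive {φ : ℂ → ℂ} (hφ : DifferentiableOn ℂ φ {z : ℂ | 0 < z.im})
    (hb : ∀ z : ℂ, 0 < z.im → ‖φ z‖ ≤ 1) :
    ∃ g : ℂ → ℂ, Continuous g ∧ ∀ z : ℂ, 0 < z.im → HasDerivAt g (φ z) z := by
  obtain ⟨Φ, hΦ⟩ := exists_primitive_uhp hφ
  have hconv : Convex ℝ {z : ℂ | 0 < z.im} := convex_halfSpace_im_gt 0
  have hL : LipschitzOnWith 1 Φ {z : ℂ | 0 < z.im} := by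
    apply hconv.lipschitzOnWith_of_nnnorm_hasDerivWithin_le (f' := φ)
    · intro z hz
      exact (hΦ z hz).hasDerivWithinAt
    · intro z hz
      exact_mod_cast hb z hz
  obtain ⟨g, hg, hEq⟩ := hL.extend_finite_dimension
  refine ⟨g, hg.continuous, fun z hz => ?_⟩
  apply (hΦ z hz).congr_of_eventuallyEq
  filter_upwards [isOpen_uhp.mem_nhds hz] with w hw
  exact (hEq hw).symm

lemma glue {φ₁ φ₂ : ℂ → ℂ} (h₁ : DifferentiableOn ℂ φ₁ {z : ℂ | 0 < z.im})
    (h₂ : DifferentiableOn ℂ φ₂ {z : ℂ | 0 < z.im})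
    (b₁ : ∀ z : ℂ, 0 < z.im → ‖φ₁ z‖ ≤ 1) (b₂ : ∀ z : ℂ, 0 < z.im → ‖φ₂ z‖ ≤ 1)
    (hae : ∀ᵐ x : ℝ, x ∈ Set.Ioo (-2:ℝ) 2 →
      Tendsto (fun y : ℝ => φ₁ (↑x + ↑y * I) - starRingEnd ℂ (φ₂ (↑x + ↑y * I)))
        (nhdsWithin 0 (Set.Ioi 0)) (nhds 0)) :
    ∃ E : ℂ → ℂ, DifferentiableOn ℂ E Omega22 ∧ (∀ z : ℂ, 0 < z.im → E z = φ₁ z) ∧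
      ∀ z : ℂ, z.im < 0 → E z = starRingEnd ℂ (φ₂ (starRingEnd ℂ z)) := by
  obtain ⟨g₁, c₁, d₁⟩ := exists_lip_primitive h₁ b₁
  obtain ⟨g₂, c₂, d₂⟩ := exists_lip_primitive h₂ b₂
  have hcj : Continuous (starRingEnd ℂ) := Complex.continuous_conj
  have im_line : ∀ t y : ℝ, ((t : ℂ) + y * I).im = y := by intro t y; simp
  -- constancy of the difference on the real interval
  have key : ∀ x ∈ Ioo (-2:ℝ) 2, g₁ x - starRingEnd ℂ (g₂ x) = g₁ 0 - starRingEnd ℂ (g₂ 0) := by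
    intro x hx
    set h : ℝ → ℝ → ℂ := fun y t => φ₁ (t + y * I) - starRingEnd ℂ (φ₂ (t + y * I)) with hh
    have hcont : ∀ y : ℝ, 0 < y → Continuous (h y) := by
      intro y hy
      have l : Continuous (fun t : ℝ => (t : ℂ) + y * I) := by fun_prop
      have k1 : Continuous (fun t : ℝ => φ₁ (t + y * I)) :=
        h₁.continuousOn.comp_continuous l (fun t => by simpa using hy)
      have k2 : Continuous (fun t : ℝ => φ₂ (t + y * I)) :=
        h₂.continuousOn.comp_continuous l (fun t => by simpa using hy)
      exact k1.sub (hcj.comp k2)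
    have hftc : ∀ y : ℝ, 0 < y → ∫ t in (0:ℝ)..x, h y t =
        (g₁ (x + y * I) - starRingEnd ℂ (g₂ (x + y * I))) -
        (g₁ ((0:ℝ) + y * I) - starRingEnd ℂ (g₂ ((0:ℝ) + y * I))) := by
      intro y hy
      apply intervalIntegral.integral_eq_sub_of_hasDerivAt
        (f := fun t : ℝ => g₁ (t + y * I) - starRingEnd ℂ (g₂ (t + y * I)))
      · intro t _
        have l : HasDerivAt (fun t : ℝ => (t : ℂ) + y * I) 1 t :=
          (Complex.ofRealCLM.hasDerivAt (x := t)).add_const _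
        have e1 := (d₁ (t + y * I) (by simpa using hy)).comp t l
        have e2 := (d₂ (t + y * I) (by simpa using hy)).comp t l
        have e3 := (Complex.conjCLE.toContinuousLinearMap.hasFDerivAt).comp_hasDerivAt t e2
        have e4 := e1.sub e3
        refine e4.congr_deriv ?_
        simp [hh]
      · exact (hcont y hy).intervalIntegrable _ _
    have hlim0 : Tendsto (fun y : ℝ => ∫ t in (0:ℝ)..x, h y t) (nhdsWithin 0 (Set.Ioi 0))
        (nhds (∫ _t in (0:ℝ)..x, (0:ℂ))) := by
      apply intervalIntegral.tendsto_integral_filter_of_dominated_convergence (fun _ => (2:ℝ))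
      · filter_upwards [self_mem_nhdsWithin] with y hy
        exact (hcont y hy).aestronglyMeasurable
      · filter_upwards [self_mem_nhdsWithin] with y hy
        apply ae_of_all
        intro t _
        have hy' : 0 < ((t : ℂ) + y * I).im := by simpa using hy
        calc ‖h y t‖ ≤ ‖φ₁ (t + y * I)‖ + ‖starRingEnd ℂ (φ₂ (t + y * I))‖ := norm_sub_le _ _
          _ ≤ 1 + 1 := by
            rw [RCLike.norm_conj]
            exact add_le_add (b₁ _ hy') (b₂ _ hy')
          _ = 2 := by norm_num
      · exact intervalIntegrable_const
      · filter_upwards [hae] with t ht hmem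
        apply ht
        have hsub : uIcc (0:ℝ) x ⊆ Ioo (-2) 2 :=
          (convex_Ioo (-2:ℝ) 2).ordConnected.uIcc_subset (by norm_num) hx
        exact hsub (uIoc_subset_uIcc hmem)
    have hlim1 : Tendsto (fun y : ℝ => (g₁ (x + y * I) - starRingEnd ℂ (g₂ (x + y * I))) -
        (g₁ ((0:ℝ) + y * I) - starRingEnd ℂ (g₂ ((0:ℝ) + y * I)))) (nhdsWithin 0 (Set.Ioi 0))
        (nhds ((g₁ (x + (0:ℝ) * I) - starRingEnd ℂ (g₂ (x + (0:ℝ) * I))) -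
        (g₁ ((0:ℝ) + (0:ℝ) * I) - starRingEnd ℂ (g₂ ((0:ℝ) + (0:ℝ) * I))))) := by
      apply Tendsto.mono_left _ nhdsWithin_le_nhds
      apply Continuous.tendsto
        (f := fun y : ℝ => (g₁ (x + y * I) - starRingEnd ℂ (g₂ (x + y * I))) -
        (g₁ ((0:ℝ) + y * I) - starRingEnd ℂ (g₂ ((0:ℝ) + y * I))))
      fun_prop
    have hlim2 := hlim0.congr' (by
      filter_upwards [self_mem_nhdsWithin] with y hy
      exact hftc y hy)
    have := tendsto_nhds_unique hlim1 hlim2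
    simp only [intervalIntegral.integral_zero, Complex.ofReal_zero, zero_mul, add_zero] at this
    exact sub_eq_zero.mp this
  set c : ℂ := g₁ 0 - starRingEnd ℂ (g₂ 0) with hc
  set H : ℂ → ℂ := fun z => if 0 ≤ z.im then g₁ z else starRingEnd ℂ (g₂ (starRingEnd ℂ z)) + c
    with hH
  have hHc : ContinuousOn H Omega22 := by
    apply ContinuousOn.if
    · rintro z ⟨hz, hfr⟩
      have him : z.im = 0 := by
        have h0 : frontier {z : ℂ | 0 ≤ z.im} ⊆ {z : ℂ | 0 = z.im} :=
          frontier_le_subset_eq continuous_const Complex.continuous_im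
        exact (h0 hfr).symm
      have hre : z.re ∈ Ioo (-2:ℝ) 2 := by
        rcases hz with h | h
        · exact absurd him h
        · exact h
      have hz' : z = (z.re : ℂ) := by
        apply Complex.ext <;> simp [him]
      have := key z.re hre
      rw [hz']
      simp only [Complex.conj_ofReal]
      rw [← this]; ring
    · exact c₁.continuousOn
    · exact (Continuous.add (by fun_prop) continuous_const).continuousOn
  have hup : ∀ z : ℂ, 0 < z.im → HasDerivAt H (φ₁ z) z := by
    intro z hz
    apply (d₁ z hz).congr_of_eventuallyEq
    filter_upwards [isOpen_uhp.mem_nhds hz] with w hw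
    have hw' : 0 < w.im := hw
    simp [hH, hw'.le]
  have hdn : ∀ z : ℂ, z.im < 0 → HasDerivAt H (starRingEnd ℂ (φ₂ (starRingEnd ℂ z))) z := by
    intro z hz
    have e1 := (d₂ (starRingEnd ℂ z) (by simpa using hz)).conj_conj
    rw [Complex.conj_conj] at e1
    have e2 := e1.add_const c
    apply e2.congr_of_eventuallyEq
    filter_upwards [(isOpen_lt Complex.continuous_im continuous_const).mem_nhds hz] with w hw
    have hw' : w.im < 0 := hw
    simp [hH, not_le.mpr hw']
  have hHd : DifferentiableOn ℂ H Omega22 := by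
    apply painleve isOpen_Omega22 hHc
    intro z hz
    rcases lt_or_gt_of_ne hz with h | h
    · exact (hdn z h).differentiableAt
    · exact (hup z h).differentiableAt
  exact ⟨deriv H, hHd.deriv isOpen_Omega22, fun z hz => (hup z hz).deriv,
    fun z hz => (hdn z hz).deriv⟩

/-- `M` is a common holomorphic extension of `m₊` (above) and of `-conj m₋(conj z)` (below). -/
def HasExt (mp mm : ℂ → ℂ) : Prop :=
  ∃ M : ℂ → ℂ, DifferentiableOn ℂ M Omega22 ∧ (∀ z ∈ Omega22, 0 < (M z).im) ∧
    (∀ z : ℂ, 0 < z.im → M z = mp z) ∧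
    ∀ z : ℂ, z.im < 0 → M z = -starRingEnd ℂ (mm (starRingEnd ℂ z))

lemma one_le_norm_add_I {w : ℂ} (hw : 0 < w.im) : 1 ≤ ‖w + I‖ := by
  have h := Complex.abs_im_le_norm (w + I)
  have : (w + I).im = w.im + 1 := by simp
  rw [this, abs_of_pos (by linarith)] at h
  linarith

lemma tendsto_vertical (z : ℂ) :
    Tendsto (fun y : ℝ => z + y * I) (nhdsWithin 0 (Set.Ioi 0)) (nhds z) := by
  have : Continuous (fun y : ℝ => z + y * I) := by fun_prop
  have h := this.tendsto 0
  simp only [Complex.ofReal_zero, zero_mul, add_zero] at h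
  exact h.mono_left nhdsWithin_le_nhds

lemma hasExt_of_reflectionless {mp mm : ℂ → ℂ} (hp : IsHerglotz mp) (hm : IsHerglotz mm)
    (hr : ReflectionlessOn22 mp mm) : HasExt mp mm := by
  have hI : 0 < I.im := by simp
  have hne : ∀ {w : ℂ}, 0 < w.im → w + I ≠ 0 := by
    intro w hw h
    have := one_le_norm_add_I hw
    rw [h, norm_zero] at this
    linarith
  have hlt : ∀ {w : ℂ}, 0 < w.im → ‖(w - I) / (w + I)‖ < 1 := by
    intro w hw
    have := cayley_lt hw hI
    rwa [Complex.conj_I, sub_neg_eq_add] at this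
  have hdiff : ∀ {m : ℂ → ℂ}, IsHerglotz m →
      DifferentiableOn ℂ (fun z => (m z - I) / (m z + I)) {z : ℂ | 0 < z.im} := by
    intro m hm
    exact (hm.1.sub_const _).div (hm.1.add_const _) (fun z hz => hne (hm.2 z hz))
  obtain ⟨E, hE, hE1, hE2⟩ := glue (hdiff hp) (hdiff hm) (fun z hz => (hlt (hp.2 z hz)).le)
    (fun z hz => (hlt (hm.2 z hz)).le) (by
      filter_upwards [hr] with x hx hmem
      have h1 := (hx hmem).norm
      rw [norm_zero] at h1
      have h2 := h1.const_mul 2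
      rw [mul_zero] at h2
      refine squeeze_zero_norm' ?_ h2
      filter_upwards [self_mem_nhdsWithin] with y hy
      have hy' : 0 < ((x : ℂ) + y * I).im := by simpa using hy
      set u := mp (x + y * I) with hu
      set v := mm (x + y * I) with hv
      have hu0 : 0 < u.im := hp.2 _ hy'
      have hv0 : 0 < v.im := hm.2 _ hy'
      have n1 := hne hu0
      have n2 := hne hv0
      have n3 : starRingEnd ℂ v - I ≠ 0 := by
        intro h
        apply n2
        have := congrArg (starRingEnd ℂ) h
        simpa using this
      have e : (u - I) / (u + I) - starRingEnd ℂ ((v - I) / (v + I)) =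
          -2 * I * (u + starRingEnd ℂ v) / ((u + I) * (starRingEnd ℂ v - I)) := by
        rw [map_div₀, map_sub, map_add, Complex.conj_I]
        rw [show starRingEnd ℂ v + -I = starRingEnd ℂ v - I by ring]
        field_simp
        ring
      rw [e, norm_div, norm_mul, norm_mul, norm_mul]
      have h3 : ‖starRingEnd ℂ v - I‖ = ‖v + I‖ := by
        rw [← RCLike.norm_conj]; simp
      rw [h3]
      have k1 := one_le_norm_add_I hu0
      have k2 := one_le_norm_add_I hv0
      have k3 : 1 ≤ ‖u + I‖ * ‖v + I‖ := one_le_mul_of_one_le_of_one_le k1 k2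
      rw [div_le_iff₀ (by linarith)]
      simp
      nlinarith [norm_nonneg (u + starRingEnd ℂ v)])
  have hE_up : ∀ z : ℂ, 0 < z.im → ‖E z‖ < 1 := by
    intro z hz
    rw [hE1 z hz]; exact hlt (hp.2 z hz)
  have hE_dn : ∀ z : ℂ, z.im < 0 → ‖E z‖ < 1 := by
    intro z hz
    rw [hE2 z hz, RCLike.norm_conj]
    exact hlt (hm.2 _ (by simpa using hz))
  have hup_ev : ∀ z : ℂ, z.im = 0 →
      ∀ᶠ y : ℝ in nhdsWithin 0 (Set.Ioi 0), 0 < (z + y * I).im := by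
    intro z hz
    filter_upwards [self_mem_nhdsWithin] with y hy
    simpa [hz] using hy
  have hE_le : ∀ z ∈ Omega22, ‖E z‖ ≤ 1 := by
    intro z hz
    rcases lt_trichotomy z.im 0 with h | h | h
    · exact (hE_dn z h).le
    · have hc : ContinuousAt E z :=
        (hE.differentiableAt (isOpen_Omega22.mem_nhds hz)).continuousAt
      have := (hc.tendsto.comp (tendsto_vertical z)).norm
      refine le_of_tendsto this ?_
      filter_upwards [hup_ev z h] with y hy
      exact (hE_up _ hy).le
    · exact (hE_up z h).le
  have hE_lt : ∀ z ∈ Omega22, ‖E z‖ < 1 := by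
    intro z hz
    rcases lt_trichotomy z.im 0 with h | h | h
    · exact hE_dn z h
    · by_contra hcon
      have h1 : ‖E z‖ = 1 := le_antisymm (hE_le z hz) (not_lt.mp hcon)
      have hmax : IsLocalMax (norm ∘ E) z := by
        filter_upwards [isOpen_Omega22.mem_nhds hz] with w hw
        simpa [h1] using hE_le w hw
      have hev := Complex.norm_eventually_eq_of_isLocalMax
        (hE.eventually_differentiableAt (isOpen_Omega22.mem_nhds hz)) hmax
      have h2 := ((tendsto_vertical z).eventually hev).and (hup_ev z h)
      obtain ⟨y, hy1, hy2⟩ := h2.exists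
      have := hE_up _ hy2
      rw [hy1, h1] at this
      exact lt_irrefl _ this
    · exact hE_up z h
  refine ⟨fun z => (I - starRingEnd ℂ I * E z) / (1 - E z), ?_, ?_, ?_, ?_⟩
  · refine DifferentiableOn.div ((hE.const_mul _).const_sub _) (hE.const_sub _) ?_
    intro z hz
    exact one_sub_ne_of_norm_lt (hE_lt z hz)
  · intro z hz
    exact invCayley_im hI (hE_lt z hz)
  · intro z hz
    have n1 := hne (hp.2 z hz)
    have n2 := one_sub_ne_of_norm_lt (hE_up z hz)
    simp only
    rw [div_eq_iff n2, hE1 z hz, Complex.conj_I]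
    field_simp
    ring
  · intro z hz
    have n1 := hne (hm.2 (starRingEnd ℂ z) (by simpa using hz))
    have n2 := one_sub_ne_of_norm_lt (hE_dn z hz)
    simp only
    rw [div_eq_iff n2, hE2 z hz, Complex.conj_I]
    set v := mm (starRingEnd ℂ z)
    have n3 : starRingEnd ℂ v - I ≠ 0 := by
      intro h
      apply n1
      have := congrArg (starRingEnd ℂ) h
      simpa using this
    rw [map_div₀, map_sub, map_add, Complex.conj_I]
    rw [show starRingEnd ℂ v + -I = starRingEnd ℂ v - I by ring]
    field_simp
    ring

lemma tendsto_sub_inv : Tendsto (fun R : ℝ => R - 1 / R) atTop atTop := by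
  have h : Tendsto (fun R : ℝ => R + (-1)) atTop atTop :=
    tendsto_atTop_add_const_right _ _ tendsto_id
  refine tendsto_atTop_mono' _ ?_ h
  filter_upwards [eventually_ge_atTop (1:ℝ)] with R hR
  have : 1 / R ≤ 1 := by
    rw [div_le_one (by linarith)]; exact hR
  linarith

lemma tendsto_one_div_real : Tendsto (fun R : ℝ => 1 / R) atTop (nhds 0) := by
  simpa using tendsto_inv_atTop_zero (𝕜 := ℝ)

lemma tendsto_ratio : Tendsto (fun R : ℝ => (R - 1 / R) / R) atTop (nhds 1) := by
  have h : Tendsto (fun R : ℝ => 1 - (1 / R) * (1 / R)) atTop (nhds (1 - 0 * 0)) :=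
    tendsto_const_nhds.sub (tendsto_one_div_real.mul tendsto_one_div_real)
  simp only [mul_zero, sub_zero] at h
  refine h.congr' ?_
  filter_upwards [eventually_gt_atTop (0:ℝ)] with R hR
  field_simp

lemma joukowski_mem {l : ℂ} (hl : 0 < l.im) : -l - 1 / l ∈ Omega22 := by
  have hl0 : l ≠ 0 := by rintro rfl; simp at hl
  have hn : 0 < Complex.normSq l := Complex.normSq_pos.mpr hl0
  by_cases h : (-l - 1 / l).im = 0
  · right
    have him : (-l - 1 / l).im = -l.im + l.im / Complex.normSq l := by
      simp [Complex.inv_im]; ring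
    have hre : (-l - 1 / l).re = -l.re - l.re / Complex.normSq l := by
      simp [Complex.inv_re]
    rw [him] at h
    have h1 : Complex.normSq l = 1 := by
      field_simp at h
      have : l.im * (1 - Complex.normSq l) = 0 := by linarith
      rcases mul_eq_zero.mp this with h2 | h2
      · exact absurd h2 hl.ne'
      · linarith
    rw [hre, h1]
    rw [Complex.normSq_apply] at h1
    constructor <;> nlinarith
  · left; exact h

lemma site_lemma {mp mm : ℂ → ℂ} {B : ℝ} (hB : 0 < B) (hext : HasExt mp mm)
    (h1 : Tendsto (fun s : ℝ => (s : ℂ) * mp (s * I)) atTop (nhds I))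
    (h2 : Tendsto (fun s : ℝ => mm (s * I) / (s : ℂ)) atTop (nhds (B * I))) :
    B ≤ 1 ∧ (B = 1 → (∀ y : ℝ, 0 < y → y < 1 → mp (((1 / y - y : ℝ) : ℂ) * I) = y * I) ∧
      ∀ y : ℝ, 1 < y → mm (((y - 1 / y : ℝ) : ℂ) * I) = y * I) := by
  obtain ⟨M, hMd, hMp, hMu, hML⟩ := hext
  set F : ℂ → ℂ := fun l => M (-l - 1 / l) with hF
  have hFd : DifferentiableOn ℂ F {z : ℂ | 0 < z.im} := by
    apply hMd.comp _ (fun l hl => joukowski_mem hl)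
    apply DifferentiableOn.sub (by fun_prop)
    apply DifferentiableOn.div (by fun_prop) (by fun_prop)
    intro l hl h0
    have hl' : 0 < l.im := hl
    rw [h0] at hl'; simp at hl'
  have hFp : ∀ z : ℂ, 0 < z.im → 0 < (F z).im := fun z hz => hMp _ (joukowski_mem hz)
  have harg : ∀ y : ℝ, 0 < y → -((y : ℂ) * I) - 1 / ((y : ℂ) * I) = ((1 / y - y : ℝ) : ℂ) * I := by
    intro y hy
    have hy' : (y : ℂ) ≠ 0 := by exact_mod_cast hy.ne'
    have := Complex.I_ne_zero
    push_cast
    field_simp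
    ring_nf
    simp
    ring
  have hFsmall : ∀ y : ℝ, 0 < y → y < 1 → F (y * I) = mp (((1 / y - y : ℝ) : ℂ) * I) := by
    intro y hy hy1
    simp only [hF]
    rw [harg y hy]
    apply hMu
    have : y < 1 / y := by
      rw [lt_div_iff₀ hy]; nlinarith
    simp only [Complex.mul_im, Complex.ofReal_re, Complex.I_im, mul_one, Complex.ofReal_im,
      Complex.I_re, mul_zero, add_zero]
    linarith
  have hFlarge : ∀ y : ℝ, 1 < y →
      F (y * I) = -starRingEnd ℂ (mm (((y - 1 / y : ℝ) : ℂ) * I)) := by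
    intro y hy1
    have hy : 0 < y := by linarith
    simp only [hF]
    rw [harg y hy]
    have h3 : 1 / y < y := by
      rw [div_lt_iff₀ hy]; nlinarith
    rw [hML]
    · congr 3
      rw [map_mul, Complex.conj_ofReal, Complex.conj_I]
      push_cast; ring
    · simp only [Complex.mul_im, Complex.ofReal_re, Complex.I_im, mul_one, Complex.ofReal_im,
        Complex.I_re, mul_zero, add_zero]
      linarith
  have hratC : Tendsto (fun R : ℝ => (((R - 1 / R) / R : ℝ) : ℂ)) atTop (nhds 1) := by
    have := (Complex.continuous_ofReal.tendsto 1).comp tendsto_ratio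
    rw [Complex.ofReal_one] at this
    exact this
  have hL : Tendsto (fun R : ℝ => F (R * I) / R) atTop (nhds (B * I)) := by
    have k := h2.comp tendsto_sub_inv
    have k2 := ((Complex.continuous_conj.tendsto _).comp k).neg.mul hratC
    have e : -(starRingEnd ℂ (B * I)) * 1 = B * I := by simp
    rw [e] at k2
    refine k2.congr' ?_
    filter_upwards [eventually_gt_atTop (1:ℝ)] with R hR
    rw [hFlarge R hR]
    have hR0 : 0 < R := by linarith
    have h3 : 1 / R < R := by
      rw [div_lt_iff₀ hR0]; nlinarith
    have hs : ((R - 1 / R : ℝ) : ℂ) ≠ 0 := by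
      have : R - 1 / R ≠ 0 := by linarith
      exact_mod_cast this
    have hRc : (R : ℂ) ≠ 0 := by exact_mod_cast hR0.ne'
    simp only [Function.comp_apply, map_div₀, Complex.conj_ofReal]
    rw [Complex.ofReal_div]
    generalize ((R - 1 / R : ℝ) : ℂ) = s at hs ⊢
    field_simp
  have hS : Tendsto (fun R : ℝ => F (((1 / R : ℝ) : ℂ) * I) * R) atTop (nhds I) := by
    have k := h1.comp tendsto_sub_inv
    have k2 := k.div hratC one_ne_zero
    rw [div_one] at k2
    refine k2.congr' ?_
    filter_upwards [eventually_gt_atTop (1:ℝ)] with R hR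
    have hR0 : 0 < R := by linarith
    have h3 : 1 / R < R := by
      rw [div_lt_iff₀ hR0]; nlinarith
    rw [hFsmall (1 / R) (by positivity) (by rw [div_lt_one hR0]; exact hR)]
    have hs : ((R - 1 / R : ℝ) : ℂ) ≠ 0 := by
      have : R - 1 / R ≠ 0 := by linarith
      exact_mod_cast this
    have hRc : (R : ℂ) ≠ 0 := by exact_mod_cast hR0.ne'
    simp only [Function.comp_apply, Pi.div_apply, one_div_one_div]
    rw [Complex.ofReal_div]
    generalize ((R - 1 / R : ℝ) : ℂ) = s at hs ⊢
    field_simp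
  have hinvC : Tendsto (fun R : ℝ => ((1 / R : ℝ) : ℂ)) atTop (nhds 0) := by
    have := (Complex.continuous_ofReal.tendsto 0).comp tendsto_one_div_real
    rw [Complex.ofReal_zero] at this
    exact this
  have hcn : Continuous (fun z : ℂ => Complex.normSq z) := Complex.continuous_normSq
  have hci : Continuous (fun z : ℂ => z.im) := Complex.continuous_im
  -- the two Julia inequalities
  have J1 : ∀ y : ℝ, 0 < y → B * y ≤ (F (y * I)).im := by
    intro y hy
    set P := F (y * I) with hP
    have l1 : Tendsto (fun R : ℝ => Complex.normSq (F (R * I) / R - P * ((1 / R : ℝ) : ℂ)) * y)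
        atTop (nhds (Complex.normSq (B * I - P * 0) * y)) :=
      ((hcn.tendsto _).comp (hL.sub (hinvC.const_mul P))).mul_const y
    have l2 : Tendsto (fun R : ℝ => (1 - y * (1 / R)) ^ 2 * ((F (R * I) / R).im * P.im))
        atTop (nhds ((1 - y * 0) ^ 2 * ((B * I : ℂ).im * P.im))) :=
      ((tendsto_const_nhds.sub (tendsto_one_div_real.const_mul y)).pow 2).mul
        (((hci.tendsto _).comp hL).mul_const _)
    have := le_of_tendsto_of_tendsto l1 l2 (by
      filter_upwards [eventually_gt_atTop (0:ℝ)] with R hR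
      have pk := pick_ineq hFd hFp (w := R * I) (p := y * I) (by simpa using hR) (by simpa using hy)
      have e1 : F (R * I) / R - P * ((1 / R : ℝ) : ℂ) = (F (R * I) - P) * ((1 / R : ℝ) : ℂ) := by
        push_cast; ring
      have e2 : (F (R * I) / R).im = (F (R * I)).im / R := Complex.div_ofReal_im _ _
      have e3 : Complex.normSq ((R : ℂ) * I - y * I) = (R - y) ^ 2 := by
        simp [Complex.normSq_apply]; ring
      rw [e3] at pk
      simp only [Complex.mul_im, Complex.ofReal_re, Complex.I_im, mul_one, Complex.ofReal_im,
        Complex.I_re, mul_zero, add_zero] at pk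
      rw [e1, e2, Complex.normSq_mul, Complex.normSq_ofReal]
      have e4 : Complex.normSq (F (R * I) - P) * (1 / R * (1 / R)) * y =
        (Complex.normSq (F (R * I) - P) * (R * y)) / R ^ 3 := by field_simp
      have e5 : (1 - y * (1 / R)) ^ 2 * ((F (R * I)).im / R * P.im) =
        ((R - y) ^ 2 * ((F (R * I)).im * P.im)) / R ^ 3 := by field_simp
      rw [e4, e5]
      exact div_le_div_of_nonneg_right pk (by positivity))
    simp [Complex.normSq_apply] at this
    have h5 : B * (B * y) ≤ B * P.im := by linarith
    exact le_of_mul_le_mul_left h5 hB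
  have J2 : ∀ y : ℝ, 0 < y → Complex.normSq (F (y * I)) ≤ y * (F (y * I)).im := by
    intro y hy
    set P := F (y * I) with hP
    have hS0 : Tendsto (fun R : ℝ => F (((1 / R : ℝ) : ℂ) * I)) atTop (nhds 0) := by
      have := hS.mul hinvC
      rw [mul_zero] at this
      refine this.congr' ?_
      filter_upwards [eventually_gt_atTop (0:ℝ)] with R hR
      have hRc : (R : ℂ) ≠ 0 := by exact_mod_cast hR.ne'
      push_cast
      field_simp
    have l1 : Tendsto (fun R : ℝ => Complex.normSq (F (((1 / R : ℝ) : ℂ) * I) - P) * y)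
        atTop (nhds (Complex.normSq (0 - P) * y)) :=
      ((hcn.tendsto _).comp (hS0.sub_const P)).mul_const y
    have l2 : Tendsto (fun R : ℝ => (1 / R - y) ^ 2 * ((F (((1 / R : ℝ) : ℂ) * I) * R).im * P.im))
        atTop (nhds ((0 - y) ^ 2 * (I.im * P.im))) :=
      ((tendsto_one_div_real.sub_const y).pow 2).mul
        (((hci.tendsto _).comp hS).mul_const _)
    have := le_of_tendsto_of_tendsto l1 l2 (by
      filter_upwards [eventually_gt_atTop (0:ℝ)] with R hR
      have pk := pick_ineq hFd hFp (w := ((1 / R : ℝ) : ℂ) * I) (p := y * I)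
        (by simpa using hR) (by simpa using hy)
      have e2 : (F (((1 / R : ℝ) : ℂ) * I) * R).im = (F (((1 / R : ℝ) : ℂ) * I)).im * R :=
        Complex.im_mul_ofReal _ _
      have e3 : Complex.normSq (((1 / R : ℝ) : ℂ) * I - y * I) = (1 / R - y) ^ 2 := by
        rw [← sub_mul, ← Complex.ofReal_sub, Complex.normSq_mul, Complex.normSq_ofReal]
        simp; ring
      rw [e3] at pk
      simp only [Complex.mul_im, Complex.ofReal_re, Complex.I_im, mul_one, Complex.ofReal_im,
        Complex.I_re, mul_zero, add_zero] at pk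
      rw [e2]
      have e4 : Complex.normSq (F (((1 / R : ℝ) : ℂ) * I) - P) * y =
        (Complex.normSq (F (((1 / R : ℝ) : ℂ) * I) - P) * (1 / R * y)) * R := by field_simp
      have e5 : (1 / R - y) ^ 2 * ((F (((1 / R : ℝ) : ℂ) * I)).im * R * P.im) =
        ((1 / R - y) ^ 2 * ((F (((1 / R : ℝ) : ℂ) * I)).im * P.im)) * R := by ring
      rw [e4, e5]
      exact mul_le_mul_of_nonneg_right pk hR.le)
    rw [zero_sub, Complex.normSq_neg] at this
    simp only [Complex.I_im, one_mul] at this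
    have h5 : y * Complex.normSq P ≤ y * (y * P.im) := by linarith
    exact le_of_mul_le_mul_left h5 hy
  have hFle : ∀ y : ℝ, 0 < y → (F (y * I)).im ≤ y := by
    intro y hy
    have a1 := J2 y hy
    have a2 := hFp (y * I) (by simpa using hy)
    rw [Complex.normSq_apply] at a1
    nlinarith [mul_self_nonneg (F (y * I)).re]
  refine ⟨?_, ?_⟩
  · have a1 := J1 1 one_pos
    have a2 := hFle 1 one_pos
    linarith
  · intro hB1
    have hFy : ∀ y : ℝ, 0 < y → F (y * I) = y * I := by
      intro y hy
      have a1 := J1 y hy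
      have a2 := hFle y hy
      have a3 := J2 y hy
      rw [hB1, one_mul] at a1
      have a4 : (F (y * I)).im = y := le_antisymm a2 a1
      rw [Complex.normSq_apply, a4] at a3
      have a5 : (F (y * I)).re * (F (y * I)).re = 0 :=
        le_antisymm (by linarith) (mul_self_nonneg _)
      have a6 : (F (y * I)).re = 0 := by simpa using a5
      apply Complex.ext
      · simp [a6]
      · simp [a4]
    refine ⟨?_, ?_⟩
    · intro y hy hy1
      rw [← hFsmall y hy hy1, hFy y hy]
    · intro y hy1
      have b1 := hFlarge y hy1
      rw [hFy y (by linarith)] at b1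
      have b2 := congrArg (starRingEnd ℂ) b1
      simp only [map_neg, Complex.conj_conj, map_mul, Complex.conj_ofReal, Complex.conj_I] at b2
      linear_combination b2

/-! ### Half-line Jacobi matrices -/

lemma SquareSummableAtTop.shift {f : ℤ → ℂ} (hf : SquareSummableAtTop f) (k : ℤ) :
    SquareSummableAtTop (fun n => f (n + k)) := by
  unfold SquareSummableAtTop at *
  obtain ⟨j, rfl | rfl⟩ := k.eq_nat_or_neg
  · have := (summable_nat_add_iff j).mpr hf
    refine this.congr fun n => ?_
    push_cast; rfl
  · rw [← summable_nat_add_iff j]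
    refine hf.congr fun n => ?_
    push_cast
    rw [show (n : ℤ) + j + -j = n by ring]

lemma JacobiSolution.shift {a b : ℤ → ℝ} {z : ℂ} {f : ℤ → ℂ} (h : JacobiSolution a b z f) (k : ℤ) :
    JacobiSolution (fun n => a (n + k)) (fun n => b (n + k)) z (fun n => f (n + k)) := by
  intro n
  have := h (n + k)
  rw [show n + k + 1 = n + 1 + k by ring, show n + k - 1 = n - 1 + k by ring] at this
  exact this

lemma JacobiSolution.const_mul {a b : ℤ → ℝ} {z : ℂ} {f : ℤ → ℂ} (h : JacobiSolution a b z f)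
    (c : ℂ) : JacobiSolution a b z (fun n => c * f n) := by
  intro n
  linear_combination c * h n

lemma SquareSummableAtTop.const_mul {f : ℤ → ℂ} (hf : SquareSummableAtTop f) (c : ℂ) :
    SquareSummableAtTop (fun n => c * f n) := by
  unfold SquareSummableAtTop at *
  refine (hf.mul_left (‖c‖ ^ 2)).congr fun n => ?_
  rw [norm_mul, mul_pow]

/-- Reflection of solutions. -/
lemma JacobiSolution.reflect {a b : ℤ → ℝ} {z : ℂ} {f : ℤ → ℂ} (h : JacobiSolution a b z f) :
    JacobiSolution (fun n => a (-n - 1)) (fun n => b (-n)) z (fun n => f (-n)) := by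
  intro n
  have := h (-n)
  rw [show -n + 1 = -(n - 1) by ring, show -n - 1 = -(n + 1) by ring] at this
  simp only
  rw [show -(n - 1) - 1 = -n by ring, show -n - 1 = -(n + 1) by ring]
  linear_combination this

lemma sq_tendsto {f : ℤ → ℂ} (hf : SquareSummableAtTop f) :
    Tendsto (fun n : ℕ => f n) atTop (nhds 0) := by
  have h := hf.tendsto_atTop_zero
  rw [tendsto_zero_iff_norm_tendsto_zero]
  have h2 := (Real.continuous_sqrt.tendsto 0).comp h
  rw [Real.sqrt_zero] at h2
  refine h2.congr fun n => ?_
  simp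

/-- The difference expression. -/
def jacOp (a b : ℤ → ℝ) (u : ℤ → ℂ) (n : ℤ) : ℂ :=
  (a n : ℂ) * u (n + 1) + (a (n - 1) : ℂ) * u (n - 1) + (b n : ℂ) * u n

lemma green {a b : ℤ → ℝ} {C : ℝ} (ha : ∀ n, 0 < a n) (haC : ∀ n, a n ≤ C) {u v : ℤ → ℂ}
    (hu : SquareSummableAtTop u) (hv : SquareSummableAtTop v) :
    Tendsto (fun N : ℕ => ∑ n ∈ Finset.range N,
      (jacOp a b u (n + 1) * v (n + 1) - u (n + 1) * jacOp a b v (n + 1))) atTop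
      (nhds ((a 0 : ℂ) * (u 0 * v 1 - u 1 * v 0))) := by
  set W : ℕ → ℂ := fun n => (a n : ℂ) * (u (n + 1) * v n - u n * v (n + 1)) with hW
  have hterm : ∀ n : ℕ, jacOp a b u (n + 1) * v (n + 1) - u (n + 1) * jacOp a b v (n + 1) =
      W (n + 1) - W n := by
    intro n
    simp only [jacOp, hW]
    push_cast
    rw [show (n : ℤ) + 1 - 1 = n by ring]
    ring
  have hsum : ∀ N : ℕ, ∑ n ∈ Finset.range N,
      (jacOp a b u (n + 1) * v (n + 1) - u (n + 1) * jacOp a b v (n + 1)) = W N - W 0 := by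
    intro N
    rw [Finset.sum_congr rfl (fun n _ => hterm n), Finset.sum_range_sub]
  have hW0 : Tendsto W atTop (nhds 0) := by
    have u0 := sq_tendsto hu
    have v0 := sq_tendsto hv
    have u1 := sq_tendsto (hu.shift 1)
    have v1 := sq_tendsto (hv.shift 1)
    have t := ((u1.mul v0).sub (u0.mul v1))
    simp only [mul_zero, sub_zero] at t
    apply squeeze_zero_norm (a := fun n : ℕ => C * ‖u (n + 1) * v n - u n * v (n + 1)‖)
    · intro n
      simp only [hW]
      rw [norm_mul, Complex.norm_real, Real.norm_of_nonneg (ha n).le]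
      exact mul_le_mul_of_nonneg_right (haC n) (norm_nonneg _)
    · simpa using t.norm.const_mul C
  have := hW0.sub_const (W 0)
  refine (this.congr (fun N => (hsum N).symm)).trans ?_
  apply le_of_eq
  congr 1
  simp [hW]
  ring

lemma jacOp_sol {a b : ℤ → ℝ} {z : ℂ} {f : ℤ → ℂ} (h : JacobiSolution a b z f) (n : ℤ) :
    jacOp a b f n = z * f n := h n

lemma jacOp_conj {a b : ℤ → ℝ} {f : ℤ → ℂ} (n : ℤ) :
    jacOp a b (fun k => starRingEnd ℂ (f k)) n = starRingEnd ℂ (jacOp a b f n) := by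
  simp [jacOp]

lemma sq_conj {f : ℤ → ℂ} (hf : SquareSummableAtTop f) :
    SquareSummableAtTop (fun k => starRingEnd ℂ (f k)) := by
  unfold SquareSummableAtTop at *
  simpa using hf

lemma sq_sub {f g : ℤ → ℂ} (hf : SquareSummableAtTop f) (hg : SquareSummableAtTop g) :
    SquareSummableAtTop (fun k => f k - g k) := by
  unfold SquareSummableAtTop at *
  refine Summable.of_nonneg_of_le (fun n => by positivity) (fun n => ?_)
    ((hf.mul_left 2).add (hg.mul_left 2))
  have := norm_sub_le (f n) (g n)
  have h2 : ‖f n - g n‖ ^ 2 ≤ (‖f n‖ + ‖g n‖) ^ 2 := by gcongr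
  nlinarith [sq_nonneg (‖f n‖ - ‖g n‖)]

lemma sq_succ {f : ℤ → ℂ} (hf : SquareSummableAtTop f) :
    Summable (fun n : ℕ => ‖f (n + 1)‖ ^ 2) := hf.shift 1

lemma summable_prod {f g : ℤ → ℂ} (hf : SquareSummableAtTop f) (hg : SquareSummableAtTop g) :
    Summable (fun n : ℕ => f (n + 1) * g (n + 1)) := by
  refine Summable.of_norm_bounded ((sq_succ hf).add (sq_succ hg)) (fun n => ?_)
  rw [norm_mul]
  nlinarith [sq_nonneg (‖f (n + 1)‖ - ‖g (n + 1)‖), sq_nonneg (‖f (n + 1)‖), sq_nonneg (‖g (n + 1)‖)]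

lemma norm_tsum_prod_le {f g : ℤ → ℂ} (hf : SquareSummableAtTop f) (hg : SquareSummableAtTop g)
    {t : ℝ} (ht : 0 < t) :
    ‖∑' n : ℕ, f (n + 1) * g (n + 1)‖ ≤
      (t * ∑' n : ℕ, ‖f (n + 1)‖ ^ 2) / 2 + (t⁻¹ * ∑' n : ℕ, ‖g (n + 1)‖ ^ 2) / 2 := by
  have h := (((sq_succ hf).hasSum.mul_left t).div_const 2).add
    (((sq_succ hg).hasSum.mul_left t⁻¹).div_const 2)
  refine tsum_of_norm_bounded h (fun n => ?_)
  rw [norm_mul]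
  set x := ‖f (n + 1)‖
  set y := ‖g (n + 1)‖
  have : (t * x ^ 2) / 2 + (t⁻¹ * y ^ 2) / 2 - x * y = t⁻¹ * (t * x - y) ^ 2 / 2 := by
    field_simp; ring
  have h2 : 0 ≤ t⁻¹ * (t * x - y) ^ 2 / 2 := by positivity
  linarith

/-- The basic identity `Im z ∑ |f|² = -a₀ Im (f(1) conj f(0))`. -/
lemma energy {a b : ℤ → ℝ} {C : ℝ} (ha : ∀ n, 0 < a n) (haC : ∀ n, a n ≤ C) {z : ℂ} {f : ℤ → ℂ}
    (hs : JacobiSolution a b z f) (hf : SquareSummableAtTop f) :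
    z.im * ∑' n : ℕ, ‖f (n + 1)‖ ^ 2 = -(a 0 * (f 1 * starRingEnd ℂ (f 0)).im) := by
  have h1 := green (b := b) ha haC hf (sq_conj hf)
  have h2 : ∀ n : ℕ, jacOp a b f (n + 1) * starRingEnd ℂ (f (n + 1)) -
      f (n + 1) * jacOp a b (fun k => starRingEnd ℂ (f k)) (n + 1) =
      (((2 * z.im * ‖f (n + 1)‖ ^ 2 : ℝ)) : ℂ) * I := by
    intro n
    rw [jacOp_conj, jacOp_sol hs, map_mul]
    have e : f (n + 1) * starRingEnd ℂ (f (n + 1)) = ((‖f (n + 1)‖ ^ 2 : ℝ) : ℂ) := by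
      rw [Complex.mul_conj, Complex.normSq_eq_norm_sq]
    have e2 : z - starRingEnd ℂ z = (2 * z.im : ℝ) * I := Complex.sub_conj z
    push_cast at e e2 ⊢
    linear_combination (z - starRingEnd ℂ z) * e + (‖f (n + 1)‖ : ℂ) ^ 2 * e2
  have h3 := h1.congr (fun N => Finset.sum_congr rfl (fun n _ => h2 n))
  have h4 := (Complex.continuous_im.tendsto _).comp h3
  have h5 : Tendsto (fun N : ℕ => ∑ n ∈ Finset.range N, 2 * z.im * ‖f (n + 1)‖ ^ 2) atTop
      (nhds (2 * z.im * ∑' n : ℕ, ‖f (n + 1)‖ ^ 2)) :=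
    ((sq_succ hf).hasSum.mul_left _).tendsto_sum_nat
  have h6 := tendsto_nhds_unique h5 (h4.congr (fun N => by
    simp only [Function.comp_apply, Complex.im_sum]
    refine Finset.sum_congr rfl (fun n _ => ?_)
    rw [Complex.im_ofReal_mul]; simp))
  rw [Complex.im_ofReal_mul] at h6
  simp only [Complex.sub_im, Complex.mul_im, Complex.conj_re, Complex.conj_im] at h6 ⊢
  linarith


lemma sum_zero_imp {f : ℤ → ℂ} (hf : SquareSummableAtTop f)
    (h0 : ∑' n : ℕ, ‖f (n + 1)‖ ^ 2 = 0) (n : ℕ) : f (n + 1) = 0 := by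
  have h := (sq_succ hf).hasSum
  rw [h0] at h
  have h2 := (hasSum_zero_iff_of_nonneg (fun n => by positivity)).mp h
  have h3 := congrFun h2 n
  simpa using h3

lemma sum_pos_of_ne {a b : ℤ → ℝ} (ha : ∀ n, 0 < a n) {z : ℂ} {f : ℤ → ℂ}
    (hs : JacobiSolution a b z f) (hf : SquareSummableAtTop f) (h0 : f 0 ≠ 0) :
    0 < ∑' n : ℕ, ‖f (n + 1)‖ ^ 2 := by
  have hn : 0 ≤ ∑' n : ℕ, ‖f (n + 1)‖ ^ 2 := tsum_nonneg (fun n => by positivity)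
  rcases hn.eq_or_lt with h | h
  · exfalso
    have h1 : f 1 = 0 := by simpa using sum_zero_imp hf h.symm 0
    have h2 : f 2 = 0 := by simpa [show (1 : ℤ) + 1 = 2 by norm_num] using sum_zero_imp hf h.symm 1
    have h3 := hs 1
    simp only [show (1 : ℤ) + 1 = 2 by norm_num, sub_self, h1, h2] at h3
    have h4 : (a 0 : ℂ) ≠ 0 := by exact_mod_cast (ha 0).ne'
    apply h0
    simpa [h4] using h3
  · exact h

lemma half_line_bounds {a b : ℤ → ℝ} {C : ℝ} (ha : ∀ n, 0 < a n) (haC : ∀ n, a n ≤ C)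
    (hbC : ∀ n, |b n| ≤ C) {z : ℂ} (hz : 0 < z.im) {f : ℤ → ℂ}
    (hs : JacobiSolution a b z f) (hf : SquareSummableAtTop f) (h0 : f 0 = -(1 / (a 0 : ℂ))) :
    (f 1).im = z.im * ∑' n : ℕ, ‖f (n + 1)‖ ^ 2 ∧ 0 < (f 1).im ∧ ‖f 1‖ ≤ 1 / z.im ∧
      ‖z * f 1 + 1‖ ≤ 2 * C / z.im := by
  have ha0 : (a 0 : ℂ) ≠ 0 := by exact_mod_cast (ha 0).ne'
  have he := energy ha haC hs hf
  have hS := sum_pos_of_ne ha hs hf (by rw [h0]; simp [ha0])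
  set S := ∑' n : ℕ, ‖f (n + 1)‖ ^ 2 with hSdef
  have him : (f 1).im = z.im * S := by
    rw [he, h0]
    have : (starRingEnd ℂ) (-(1 / (a 0 : ℂ))) = ((-(1 / a 0) : ℝ) : ℂ) := by
      simp
    rw [this, mul_comm (f 1), Complex.im_ofReal_mul]
    have := (ha 0).ne'
    field_simp
  have h1S : ‖f 1‖ ^ 2 ≤ S := by
    have := (sq_succ hf).le_tsum 0 (fun n _ => by positivity)
    simpa using this
  have h2S : ‖f 2‖ ^ 2 ≤ S := by
    have := (sq_succ hf).le_tsum 1 (fun n _ => by positivity)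
    simpa [show (1 : ℤ) + 1 = 2 by norm_num] using this
  have hpos : 0 < (f 1).im := by rw [him]; positivity
  have himle : (f 1).im ≤ ‖f 1‖ := Complex.im_le_norm _
  have hnp : 0 < ‖f 1‖ := lt_of_lt_of_le hpos himle
  have hm : ‖f 1‖ ≤ 1 / z.im := by
    rw [le_div_iff₀ hz]
    have : z.im * ‖f 1‖ ^ 2 ≤ ‖f 1‖ := by
      calc z.im * ‖f 1‖ ^ 2 ≤ z.im * S := by gcongr
        _ ≤ _ := by rw [← him]; exact himle
    by_contra hc
    push Not at hc
    nlinarith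
  have hSle : S ≤ (1 / z.im) ^ 2 := by
    have : z.im * S ≤ 1 / z.im := by rw [← him]; exact himle.trans hm
    have h2 : S = (z.im * S) / z.im := by field_simp
    rw [h2]
    calc (z.im * S) / z.im ≤ (1 / z.im) / z.im := by gcongr
      _ = _ := by field_simp
  have h2 : ‖f 2‖ ≤ 1 / z.im := by
    apply le_of_sq_le_sq _ (by positivity)
    exact h2S.trans hSle
  refine ⟨him, hpos, hm, ?_⟩
  have heq := hs 1
  simp only [show (1 : ℤ) + 1 = 2 by norm_num, sub_self, h0] at heq
  have : z * f 1 + 1 = (b 1 : ℂ) * f 1 + (a 1 : ℂ) * f 2 := by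
    have e : (a 0 : ℂ) * -(1 / (a 0 : ℂ)) = -1 := by field_simp
    rw [e] at heq
    linear_combination -heq
  rw [this]
  have hC : 0 ≤ C := (ha 0).le.trans (haC 0)
  calc ‖(b 1 : ℂ) * f 1 + (a 1 : ℂ) * f 2‖ ≤ ‖(b 1 : ℂ) * f 1‖ + ‖(a 1 : ℂ) * f 2‖ :=
        norm_add_le _ _
    _ = |b 1| * ‖f 1‖ + a 1 * ‖f 2‖ := by
        rw [norm_mul, norm_mul, Complex.norm_real, Complex.norm_real, Real.norm_eq_abs,
          Real.norm_of_nonneg (ha 1).le]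
    _ ≤ C * (1 / z.im) + C * (1 / z.im) := by
        gcongr
        · exact hbC 1
        · exact haC 1
    _ = _ := by ring

lemma diff_identity {a b : ℤ → ℝ} {C : ℝ} (ha : ∀ n, 0 < a n) (haC : ∀ n, a n ≤ C)
    {z w : ℂ} {f g : ℤ → ℂ}
    (hs : JacobiSolution a b z f) (hf : SquareSummableAtTop f) (h0 : f 0 = -(1 / (a 0 : ℂ)))
    (hs' : JacobiSolution a b w g) (hg : SquareSummableAtTop g) (h0' : g 0 = -(1 / (a 0 : ℂ))) :
    f 1 - g 1 = (z - w) * ∑' n : ℕ, f (n + 1) * g (n + 1) := by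
  have ha0 : (a 0 : ℂ) ≠ 0 := by exact_mod_cast (ha 0).ne'
  have h1 := green (b := b) ha haC hf hg
  have h2 := ((summable_prod hf hg).hasSum.mul_left (z - w)).tendsto_sum_nat
  have h3 := tendsto_nhds_unique h1 (h2.congr (fun N => Finset.sum_congr rfl (fun n _ => by
    rw [jacOp_sol hs, jacOp_sol hs']; ring)))
  rw [← h3, h0, h0']
  field_simp
  ring

lemma diff_energy {a b : ℤ → ℝ} {C : ℝ} (ha : ∀ n, 0 < a n) (haC : ∀ n, a n ≤ C)
    {z w : ℂ} (hz : 0 < z.im) (hzw : z ≠ w) {f g : ℤ → ℂ}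
    (hs : JacobiSolution a b z f) (hf : SquareSummableAtTop f)
    (hs' : JacobiSolution a b w g) (hg : SquareSummableAtTop g) (h0 : f 0 = g 0) :
    ∑' n : ℕ, ‖f (n + 1) - g (n + 1)‖ ^ 2 ≤
      ‖z - w‖ ^ 2 * (∑' n : ℕ, ‖g (n + 1)‖ ^ 2) / z.im ^ 2 := by
  set u : ℤ → ℂ := fun k => f k - g k with hu
  have hus : SquareSummableAtTop u := sq_sub hf hg
  have huc := sq_conj hus
  have hju : ∀ n, jacOp a b u n = z * u n + (z - w) * g n := by
    intro n
    have e1 := hs n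
    have e2 := hs' n
    simp only [jacOp, hu]
    linear_combination e1 - e2
  have h1 := green (b := b) ha haC hus huc
  have hu0 : u 0 = 0 := by simp [hu, h0]
  simp only [hu0, map_zero, mul_zero, zero_mul, sub_self] at h1
  have hterm : ∀ n : ℕ, jacOp a b u (n + 1) * starRingEnd ℂ (u (n + 1)) -
      u (n + 1) * jacOp a b (fun k => starRingEnd ℂ (u k)) (n + 1) =
      ((2 * (z.im * ‖u (n + 1)‖ ^ 2 +
        ((z - w) * (g (n + 1) * starRingEnd ℂ (u (n + 1)))).im) : ℝ) : ℂ) * I := by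
    intro n
    rw [jacOp_conj, hju, map_add, map_mul, map_mul]
    have e : u (n + 1) * starRingEnd ℂ (u (n + 1)) = ((‖u (n + 1)‖ ^ 2 : ℝ) : ℂ) := by
      rw [Complex.mul_conj, Complex.normSq_eq_norm_sq]
    have e2 : z - starRingEnd ℂ z = (2 * z.im : ℝ) * I := Complex.sub_conj z
    have e3 := Complex.sub_conj ((z - w) * (g (n + 1) * starRingEnd ℂ (u (n + 1))))
    simp only [map_mul, Complex.conj_conj] at e3
    push_cast at e e2 e3 ⊢
    linear_combination (z - starRingEnd ℂ z) * e + (‖u (n + 1)‖ : ℂ) ^ 2 * e2 + e3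
  have h2 := (Complex.continuous_im.tendsto _).comp
    (h1.congr (fun N => Finset.sum_congr rfl (fun n _ => hterm n)))
  have hsp := summable_prod hg huc
  have hs1 := ((sq_succ hus).hasSum.mul_left z.im)
  have hs2 := Complex.hasSum_im (hsp.hasSum.mul_left (z - w))
  have h3 := ((hs1.add hs2).mul_left 2).tendsto_sum_nat
  have h4 := tendsto_nhds_unique h3 (h2.congr (fun N => by
    simp only [Function.comp_apply, Complex.im_sum]
    refine Finset.sum_congr rfl (fun n _ => ?_)
    rw [Complex.im_ofReal_mul]; simp))
  simp only [Complex.zero_im] at h4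
  have hd : 0 < ‖z - w‖ := norm_pos_iff.mpr (sub_ne_zero.mpr hzw)
  have h5 := norm_tsum_prod_le hg huc (t := ‖z - w‖ / z.im) (by positivity)
  have h6 := (Complex.abs_im_le_norm ((z - w) * ∑' n : ℕ, g (n + 1) * starRingEnd ℂ (u (n + 1))))
  rw [norm_mul] at h6
  have h7 := neg_abs_le ((z - w) * ∑' n : ℕ, g (n + 1) * starRingEnd ℂ (u (n + 1))).im
  have h8 : ∑' n : ℕ, ‖starRingEnd ℂ (u (n + 1))‖ ^ 2 = ∑' n : ℕ, ‖u (n + 1)‖ ^ 2 := by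
    simp
  rw [h8] at h5
  change ∑' n : ℕ, ‖u (n + 1)‖ ^ 2 ≤ _
  set U := ∑' n : ℕ, ‖u (n + 1)‖ ^ 2
  set S := ∑' n : ℕ, ‖g (n + 1)‖ ^ 2
  set d := ‖z - w‖
  have h9 : z.im * U ≤ d * ((d / z.im * S) / 2 + ((d / z.im)⁻¹ * U) / 2) := by
    have := mul_le_mul_of_nonneg_left h5 hd.le
    linarith
  have h10 : d * ((d / z.im * S) / 2 + ((d / z.im)⁻¹ * U) / 2) = d ^ 2 * S / z.im / 2 + z.im * U / 2 := by
    field_simp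
  rw [h10] at h9
  have h11 : z.im * U ≤ d ^ 2 * S / z.im := by linarith
  rw [le_div_iff₀ (by positivity)]
  rw [le_div_iff₀ hz] at h11
  nlinarith

lemma half_line_hasDerivAt {a b : ℤ → ℝ} {C : ℝ} (ha : ∀ n, 0 < a n) (haC : ∀ n, a n ≤ C)
    {f : ℂ → ℤ → ℂ} (hs : ∀ z : ℂ, 0 < z.im → JacobiSolution a b z (f z))
    (hf : ∀ z : ℂ, 0 < z.im → SquareSummableAtTop (f z))
    (h0 : ∀ z : ℂ, 0 < z.im → f z 0 = -(1 / (a 0 : ℂ))) {w : ℂ} (hw : 0 < w.im) :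
    HasDerivAt (fun z => f z 1) (∑' n : ℕ, f w (n + 1) * f w (n + 1)) w := by
  rw [hasDerivAt_iff_tendsto_slope, tendsto_iff_norm_sub_tendsto_zero]
  set S := ∑' n : ℕ, ‖f w (n + 1)‖ ^ 2 with hS
  have hS0 : 0 ≤ S := tsum_nonneg (fun n => by positivity)
  set K := S / (w.im / 2) ^ 2 / 2 + S / 2 with hK
  have hnear : ∀ᶠ z in nhdsWithin w {w}ᶜ, w.im / 2 < z.im :=
    nhdsWithin_le_nhds (Complex.continuous_im.continuousAt.eventually
      (lt_mem_nhds (by linarith : w.im / 2 < w.im)))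
  have hlim : Tendsto (fun z => ‖z - w‖ * K) (nhdsWithin w {w}ᶜ) (nhds 0) := by
    have : Tendsto (fun z => ‖z - w‖ * K) (nhds w) (nhds (‖w - w‖ * K)) := by
      apply Continuous.tendsto; fun_prop
    rw [sub_self, norm_zero, zero_mul] at this
    exact this.mono_left nhdsWithin_le_nhds
  refine squeeze_zero' (Eventually.of_forall fun z => norm_nonneg _) ?_ hlim
  filter_upwards [hnear, self_mem_nhdsWithin] with z hz hne
  have hne : z ≠ w := hne
  have hz0 : 0 < z.im := by linarith
  have hsub : z - w ≠ 0 := sub_ne_zero.mpr hne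
  have hd : 0 < ‖z - w‖ := norm_pos_iff.mpr hsub
  have h1 := diff_identity ha haC (hs z hz0) (hf z hz0) (h0 z hz0) (hs w hw) (hf w hw) (h0 w hw)
  have h2 := diff_energy ha haC hz0 hne (hs z hz0) (hf z hz0) (hs w hw) (hf w hw)
    ((h0 z hz0).trans (h0 w hw).symm)
  rw [slope_def_field, h1, mul_div_assoc, mul_div_cancel₀ _ hsub,
    ← (summable_prod (hf z hz0) (hf w hw)).tsum_sub (summable_prod (hf w hw) (hf w hw))]
  have h3 := norm_tsum_prod_le (sq_sub (hf z hz0) (hf w hw)) (hf w hw) (t := ‖z - w‖⁻¹)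
    (by positivity)
  simp only [inv_inv] at h3
  simp only [← sub_mul]
  refine h3.trans ?_
  rw [← hS]
  have h4 : ∑' n : ℕ, ‖f z (n + 1) - f w (n + 1)‖ ^ 2 ≤ ‖z - w‖ ^ 2 * S / (w.im / 2) ^ 2 := by
    refine h2.trans ?_
    gcongr
  calc ‖z - w‖⁻¹ * (∑' n : ℕ, ‖f z (n + 1) - f w (n + 1)‖ ^ 2) / 2 + ‖z - w‖ * S / 2
      ≤ ‖z - w‖⁻¹ * (‖z - w‖ ^ 2 * S / (w.im / 2) ^ 2) / 2 + ‖z - w‖ * S / 2 := by gcongr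
    _ = ‖z - w‖ * K := by rw [hK]; field_simp

lemma half_line {a b : ℤ → ℝ} {C : ℝ} (ha : ∀ n, 0 < a n) (haC : ∀ n, a n ≤ C)
    (hbC : ∀ n, |b n| ≤ C) {g : ℂ → ℤ → ℂ} (hs : ∀ z : ℂ, 0 < z.im → JacobiSolution a b z (g z))
    (hg : ∀ z : ℂ, 0 < z.im → SquareSummableAtTop (g z))
    (hne : ∀ z : ℂ, 0 < z.im → g z 0 ≠ 0) {m : ℂ → ℂ}
    (hm : ∀ z : ℂ, 0 < z.im → m z = -(g z 1 / ((a 0 : ℂ) * g z 0))) :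
    IsHerglotz m ∧ Tendsto (fun s : ℝ => (s : ℂ) * m (s * I)) atTop (nhds I) := by
  have ha0 : (a 0 : ℂ) ≠ 0 := by exact_mod_cast (ha 0).ne'
  set f : ℂ → ℤ → ℂ := fun z n => -(1 / ((a 0 : ℂ) * g z 0)) * g z n with hf
  have fs : ∀ z : ℂ, 0 < z.im → JacobiSolution a b z (f z) := fun z hz => (hs z hz).const_mul _
  have fq : ∀ z : ℂ, 0 < z.im → SquareSummableAtTop (f z) := fun z hz => (hg z hz).const_mul _
  have f0 : ∀ z : ℂ, 0 < z.im → f z 0 = -(1 / (a 0 : ℂ)) := by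
    intro z hz
    have := hne z hz
    simp only [hf]
    field_simp
  have fm : ∀ z : ℂ, 0 < z.im → m z = f z 1 := by
    intro z hz
    rw [hm z hz]
    simp only [hf]
    ring
  have hb := fun z hz => half_line_bounds ha haC hbC hz (fs z hz) (fq z hz) (f0 z hz)
  refine ⟨⟨?_, fun z hz => ?_⟩, ?_⟩
  · have : DifferentiableOn ℂ (fun z => f z 1) {z : ℂ | 0 < z.im} := fun w hw =>
      (half_line_hasDerivAt ha haC fs fq f0 hw).differentiableAt.differentiableWithinAt
    exact this.congr fun z hz => fm z hz
  · rw [fm z hz]; exact (hb z hz).2.1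
  · rw [tendsto_iff_norm_sub_tendsto_zero]
    have hlim : Tendsto (fun s : ℝ => 2 * C / s) atTop (nhds 0) :=
      tendsto_const_nhds.div_atTop tendsto_id
    refine squeeze_zero' (Eventually.of_forall fun z => norm_nonneg _) ?_ hlim
    filter_upwards [eventually_gt_atTop 0] with s hs0
    have hi : ((s : ℂ) * I).im = s := by simp
    have h := (hb ((s : ℂ) * I) (by rw [hi]; exact hs0)).2.2.2
    rw [← fm _ (by rw [hi]; exact hs0), hi] at h
    refine le_trans (le_of_eq ?_) h
    have : (s : ℂ) * m (s * I) - I = -I * ((s : ℂ) * I * m (s * I) + 1) := by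
      linear_combination (s : ℂ) * m (s * I) * I_mul_I
    rw [this, norm_mul]
    simp

lemma sol_ne_zero {a b : ℤ → ℝ} {C : ℝ} (ha : ∀ n, 0 < a n) (haC : ∀ n, a n ≤ C)
    {z : ℂ} (hz : 0 < z.im) {f : ℤ → ℂ} (hs : JacobiSolution a b z f)
    (hf : SquareSummableAtTop f) {j : ℤ} (hj : f j ≠ 0) (k : ℤ) : f k ≠ 0 := by
  intro hk
  apply hj
  have hs' := hs.shift k
  have hf' := hf.shift k
  have he := energy (fun n => ha (n + k)) (fun n => haC (n + k)) hs' hf'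
  simp only [zero_add, hk, map_zero, mul_zero, Complex.zero_im, neg_zero] at he
  have h1 := sum_zero_imp hf' ((mul_eq_zero.mp he).resolve_left hz.ne') 0
  simp only [Nat.cast_zero, zero_add] at h1
  have key : ∀ n : ℤ, f (n + k) = 0 ∧ f (n + 1 + k) = 0 := by
    intro n
    induction n using Int.induction_on with
    | zero => simpa using ⟨hk, h1⟩
    | succ i ih =>
      refine ⟨ih.2, ?_⟩
      have h := hs' ((i : ℤ) + 1)
      simp only [add_sub_cancel_right, ih.1, ih.2, mul_zero, add_zero] at h
      exact (mul_eq_zero.mp h).resolve_left (by exact_mod_cast (ha _).ne')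
    | pred i ih =>
      have h := hs' (-(i : ℤ))
      simp only [ih.1, ih.2, mul_zero, add_zero, zero_add] at h
      refine ⟨(mul_eq_zero.mp h).resolve_left (by exact_mod_cast (ha _).ne'), ?_⟩
      rw [sub_add_cancel]; exact ih.1
  have := (key (j - k)).1
  rwa [sub_add_cancel] at this

lemma mem_Omega_of_im {z : ℂ} (h : z.im ≠ 0) : z ∈ Omega22 := Or.inl h

lemma neg_inv_im_pos {w : ℂ} (h : 0 < w.im) : 0 < (-1 / w).im := by
  have hw : w ≠ 0 := by rintro rfl; simp at h
  have : 0 < Complex.normSq w := Complex.normSq_pos.mpr hw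
  rw [neg_div, Complex.neg_im, one_div, Complex.inv_im]
  rw [neg_div, neg_neg]
  positivity

lemma hasExt_succ {mp mm mp' mm' : ℂ → ℂ} {A β : ℝ} (hA : 0 < A)
    (hp' : ∀ z : ℂ, 0 < z.im → 0 < (mp' z).im) (hm' : ∀ z : ℂ, 0 < z.im → 0 < (mm' z).im)
    (r1 : ∀ z : ℂ, 0 < z.im → -1 / mp z = z - β + A * mp' z)
    (r2 : ∀ z : ℂ, 0 < z.im → -1 / mm z = -(z - β) + A * mm' z)
    (h : HasExt mp mm) : HasExt mp' mm' := by
  obtain ⟨M, hd, hpos, hup, hlo⟩ := h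
  have hAc : (A : ℂ) ≠ 0 := by exact_mod_cast hA.ne'
  have hup' : ∀ z : ℂ, 0 < z.im → (-1 / M z - z + β) / A = mp' z := by
    intro z hz
    rw [hup z hz, r1 z hz]
    field_simp
    ring
  have hlo' : ∀ z : ℂ, z.im < 0 →
      (-1 / M z - z + β) / A = -starRingEnd ℂ (mm' (starRingEnd ℂ z)) := by
    intro z hz
    have hz' : 0 < (starRingEnd ℂ z).im := by simpa using hz
    have e := congrArg (starRingEnd ℂ) (r2 _ hz')
    simp only [map_add, map_sub, map_neg, map_mul, map_div₀, Complex.conj_conj,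
      Complex.conj_ofReal, map_one] at e
    rw [hlo z hz]
    have e2 : -1 / -(starRingEnd ℂ) (mm ((starRingEnd ℂ) z)) =
      -(-1 / (starRingEnd ℂ) (mm ((starRingEnd ℂ) z))) := by rw [div_neg]
    rw [e2, e]
    field_simp
    ring
  refine ⟨fun z => (-1 / M z - z + β) / A, ?_, ?_, hup', hlo'⟩
  · have hne : ∀ z ∈ Omega22, M z ≠ 0 := by
      intro z hz h0
      have := hpos z hz
      rw [h0] at this
      simp at this
    exact ((((differentiableOn_const (-1)).div hd hne).sub differentiableOn_id).add_const _).div_const _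
  · intro z hz
    rcases lt_trichotomy z.im 0 with h | h | h
    · simp only [hlo' z h, Complex.neg_im, Complex.conj_im, neg_neg]
      exact hm' _ (by simpa using h)
    · simp only [Complex.div_ofReal_im, Complex.add_im, Complex.sub_im, Complex.ofReal_im, h]
      have := neg_inv_im_pos (hpos z hz)
      simp only [sub_zero, add_zero]
      positivity
    · simp only [hup' z h]; exact hp' z h

lemma hasExt_pred {mp mm mp' mm' : ℂ → ℂ} {A β : ℝ} (hA : 0 < A)
    (hp : ∀ z : ℂ, 0 < z.im → 0 < (mp z).im) (hm : ∀ z : ℂ, 0 < z.im → 0 < (mm z).im)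
    (r1 : ∀ z : ℂ, 0 < z.im → -1 / mp z = z - β + A * mp' z)
    (r2 : ∀ z : ℂ, 0 < z.im → -1 / mm z = -(z - β) + A * mm' z)
    (h : HasExt mp' mm') : HasExt mp mm := by
  obtain ⟨M, hd, hpos, hup, hlo⟩ := h
  have hupD : ∀ z : ℂ, 0 < z.im → z - β + A * M z = -1 / mp z := by
    intro z hz
    rw [hup z hz, r1 z hz]
  have hloD : ∀ z : ℂ, z.im < 0 →
      z - β + A * M z = 1 / starRingEnd ℂ (mm (starRingEnd ℂ z)) := by
    intro z hz
    have hz' : 0 < (starRingEnd ℂ z).im := by simpa using hz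
    have e := congrArg (starRingEnd ℂ) (r2 _ hz')
    simp only [map_add, map_sub, map_neg, map_mul, map_div₀, Complex.conj_conj,
      Complex.conj_ofReal, map_one] at e
    rw [hlo z hz]
    have e2 : 1 / (starRingEnd ℂ) (mm ((starRingEnd ℂ) z)) =
      -(-1 / (starRingEnd ℂ) (mm ((starRingEnd ℂ) z))) := by rw [neg_div, neg_neg]
    rw [e2, e]
    ring
  have nz : ∀ w : ℂ, 0 < w.im → w ≠ 0 := by rintro w h rfl; simp at h
  have hne : ∀ z ∈ Omega22, z - β + A * M z ≠ 0 := by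
    intro z hz
    rcases lt_trichotomy z.im 0 with h | h | h
    · rw [hloD z h]
      have := nz _ (hm (starRingEnd ℂ z) (by simpa using h))
      simpa using this
    · apply nz
      have := hpos z hz
      simp only [Complex.add_im, Complex.sub_im, Complex.ofReal_im, h, Complex.im_ofReal_mul]
      simp only [sub_zero, zero_add]
      positivity
    · rw [hupD z h]
      have := nz _ (hp z h)
      simpa using this
  have hup' : ∀ z : ℂ, 0 < z.im → -1 / (z - β + A * M z) = mp z := by
    intro z hz
    have := nz _ (hp z hz)
    rw [hupD z hz]
    field_simp
  have hlo' : ∀ z : ℂ, z.im < 0 →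
      -1 / (z - β + A * M z) = -starRingEnd ℂ (mm (starRingEnd ℂ z)) := by
    intro z hz
    rw [hloD z hz, one_div, neg_div, one_div, inv_inv]
  refine ⟨fun z => -1 / (z - β + A * M z), ?_, ?_, hup', hlo'⟩
  · exact (differentiableOn_const (-1)).div
      ((differentiableOn_id.sub_const _).add (hd.const_mul _)) hne
  · intro z hz
    rcases lt_trichotomy z.im 0 with h | h | h
    · simp only [hlo' z h, Complex.neg_im, Complex.conj_im, neg_neg]
      exact hm _ (by simpa using h)
    · apply neg_inv_im_pos
      have := hpos z hz
      simp only [Complex.add_im, Complex.sub_im, Complex.ofReal_im, h, Complex.im_ofReal_mul]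
      simp only [sub_zero, zero_add]
      positivity
    · simp only [hup' z h]; exact hp z h

/-- Data comparison: if `c = i s - β + A m(i s)` etc. along `s = R - 1/R`. -/
lemma coeff_of_free {m : ℂ → ℂ} {A β : ℝ} (hm : Tendsto (fun s : ℝ => (s : ℂ) * m (s * I)) atTop (nhds I))
    (h : ∀ R : ℝ, 1 < R → (R : ℂ) * I = ((R - 1 / R : ℝ) : ℂ) * I - β + A * m (((R - 1 / R : ℝ) : ℂ) * I)) :
    β = 0 ∧ A = 1 := by
  have h1 : Tendsto (fun R : ℝ => ((R - 1 / R : ℝ) : ℂ) * m (((R - 1 / R : ℝ) : ℂ) * I)) atTop (nhds I) :=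
    hm.comp tendsto_sub_inv
  have hinv : Tendsto (fun R : ℝ => (((R - 1 / R)⁻¹ : ℝ) : ℂ)) atTop (nhds 0) := by
    have := (Complex.continuous_ofReal.tendsto 0).comp (tendsto_inv_atTop_zero.comp tendsto_sub_inv)
    simpa [Function.comp_def] using this
  have hR : Tendsto (fun R : ℝ => ((1 / R : ℝ) : ℂ)) atTop (nhds 0) := by
    have := (Complex.continuous_ofReal.tendsto 0).comp (tendsto_inv_atTop_zero (𝕜 := ℝ))
    simpa [Function.comp_def] using this
  have hm0 : Tendsto (fun R : ℝ => m (((R - 1 / R : ℝ) : ℂ) * I)) atTop (nhds 0) := by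
    have := hinv.mul h1
    rw [zero_mul] at this
    refine this.congr' ?_
    filter_upwards [tendsto_sub_inv.eventually_gt_atTop 0] with R hR
    have : ((R - 1 / R : ℝ) : ℂ) ≠ 0 := by exact_mod_cast hR.ne'
    rw [Complex.ofReal_inv, ← mul_assoc, inv_mul_cancel₀ this, one_mul]
  have e1 : ∀ R : ℝ, 1 < R → (β : ℂ) = A * m (((R - 1 / R : ℝ) : ℂ) * I) - ((1 / R : ℝ) : ℂ) * I := by
    intro R hR
    have := h R hR
    have e : ((R - 1 / R : ℝ) : ℂ) = (R : ℂ) - ((1 / R : ℝ) : ℂ) := Complex.ofReal_sub _ _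
    linear_combination this + I * e
  have hβ : (β : ℂ) = 0 := by
    have l := (hm0.const_mul (A : ℂ)).sub (hR.mul_const I)
    rw [mul_zero, zero_mul, sub_zero] at l
    refine tendsto_nhds_unique (tendsto_const_nhds.congr' ?_) l
    filter_upwards [eventually_gt_atTop 1] with R hR using e1 R hR
  refine ⟨by exact_mod_cast hβ, ?_⟩
  have hAI : (A : ℂ) * I = I := by
    have l := h1.const_mul (A : ℂ)
    have l2 : Tendsto (fun R : ℝ => (1 - ((1 / R : ℝ) : ℂ) ^ 2) * I) atTop (nhds ((1 - 0 ^ 2) * I)) :=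
      ((hR.pow 2).const_sub 1).mul_const I
    simp only [ne_eq, OfNat.ofNat_ne_zero, not_false_eq_true, zero_pow, sub_zero, one_mul] at l2
    refine tendsto_nhds_unique (l.congr' ?_) l2
    filter_upwards [eventually_gt_atTop 1] with R hR1
    have e := e1 R hR1
    rw [hβ] at e
    have hR0 : (R : ℂ) ≠ 0 := by exact_mod_cast (by linarith : R ≠ 0)
    have e3 : ((R - 1 / R : ℝ) : ℂ) * ((1 / R : ℝ) : ℂ) = 1 - ((1 / R : ℝ) : ℂ) ^ 2 := by
      push_cast
      field_simp
    linear_combination -((R - 1 / R : ℝ) : ℂ) * e + I * e3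
  have := mul_right_cancel₀ I_ne_zero (hAI.trans (one_mul I).symm)
  exact_mod_cast this

theorem statement12 (a b : ℤ → ℝ) (hpos : ∀ n : ℤ, 0 < a n)
    (hbdd : ∃ C : ℝ, ∀ n : ℤ, a n ≤ C ∧ |b n| ≤ C)
    (hrefl : JacobiReflectionless a b) :
    (∀ n : ℤ, 1 ≤ a n) ∧
    ((∃ n₀ : ℤ, a n₀ = 1) → ∀ n : ℤ, a n = 1 ∧ b n = 0) := by
  obtain ⟨C, hC⟩ := hbdd
  have haC := fun n => (hC n).1
  have hbC := fun n => (hC n).2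
  obtain ⟨mp, mm, hmp, hmm, hr⟩ := hrefl
  choose! fp fps fpq fp0 hmp using hmp
  choose! fm fms fmq fm0 hmm using hmm
  have hac : ∀ n, (a n : ℂ) ≠ 0 := fun n => by exact_mod_cast (hpos n).ne'
  have fpne : ∀ z : ℂ, 0 < z.im → ∀ n, fp z n ≠ 0 := fun z hz =>
    sol_ne_zero hpos haC hz (fps z hz) (fpq z hz) (fp0 z hz)
  have fmne : ∀ z : ℂ, 0 < z.im → ∀ n, fm z n ≠ 0 := by
    intro z hz n
    have := sol_ne_zero (fun n => hpos (-n - 1)) (fun n => haC (-n - 1)) hz (fms z hz).reflect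
      (show SquareSummableAtTop (fun n => fm z (-n)) from fmq z hz) (j := 0)
      (by simpa using fm0 z hz) (-n)
    simpa using this
  set mP : ℤ → ℂ → ℂ := fun n z => -(fp z (n + 1) / ((a n : ℂ) * fp z n)) with hmP
  set mM : ℤ → ℂ → ℂ := fun n z => fm z (n + 1) / ((a n : ℂ) * fm z n) with hmM
  set mt : ℤ → ℂ → ℂ := fun n z => -(fm z (n - 1) / ((a (n - 1) : ℂ) * fm z n)) with hmt
  have HP : ∀ n, IsHerglotz (mP n) ∧
      Tendsto (fun s : ℝ => (s : ℂ) * mP n (s * I)) atTop (nhds I) := by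
    intro n
    refine half_line (fun k => hpos (k + n)) (fun k => haC (k + n)) (fun k => hbC (k + n))
      (fun z hz => (fps z hz).shift n) (fun z hz => (fpq z hz).shift n)
      (fun z hz => fpne z hz _) (fun z hz => ?_)
    simp only [hmP, zero_add, add_comm 1 n]
  have HT : ∀ n, IsHerglotz (mt n) ∧
      Tendsto (fun s : ℝ => (s : ℂ) * mt n (s * I)) atTop (nhds I) := by
    intro n
    refine half_line (fun k => hpos (-(k + -n) - 1)) (fun k => haC (-(k + -n) - 1))
      (fun k => hbC (-(k + -n)))
      (fun z hz => (fms z hz).reflect.shift (-n))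
      (fun z hz => (show SquareSummableAtTop (fun n => fm z (-n)) from fmq z hz).shift (-n))
      (fun z hz => fmne z hz _) (fun z hz => ?_)
    simp only [hmt]
    rw [show -(1 + -n) = n - 1 by ring, show -(0 + -n) = n by ring]
  have HMT : ∀ n (z : ℂ), 0 < z.im →
      mM n z = (z - b n + ((a (n - 1) ^ 2 : ℝ) : ℂ) * mt n z) / ((a n ^ 2 : ℝ) : ℂ) := by
    intro n z hz
    have h1 := fmne z hz n
    have h2 := hac n
    have h3 := hac (n - 1)
    have h4 := fms z hz n
    simp only [hmM, hmt]
    push_cast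
    field_simp
    linear_combination h4
  have HM : ∀ n, IsHerglotz (mM n) := by
    intro n
    constructor
    · have hT := (HT n).1.1
      have : DifferentiableOn ℂ (fun z => (z - b n + ((a (n - 1) ^ 2 : ℝ) : ℂ) * mt n z) /
          ((a n ^ 2 : ℝ) : ℂ)) {z : ℂ | 0 < z.im} :=
        ((differentiableOn_id.sub_const _).add (hT.const_mul _)).div_const _
      exact this.congr fun z hz => HMT n z hz
    · intro z hz
      have := (HT n).1.2 z hz
      have h1 := hpos n
      have h2 := hpos (n - 1)
      rw [HMT n z hz, Complex.div_ofReal_im, Complex.add_im, Complex.sub_im, Complex.ofReal_im,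
        Complex.im_ofReal_mul, sub_zero]
      positivity
  have HM2 : ∀ n, Tendsto (fun s : ℝ => mM n (s * I) / (s : ℂ)) atTop
      (nhds (((1 / a n ^ 2 : ℝ) : ℂ) * I)) := by
    intro n
    have hinv : Tendsto (fun R : ℝ => ((R⁻¹ : ℝ) : ℂ)) atTop (nhds 0) := by
      have := (Complex.continuous_ofReal.tendsto 0).comp (tendsto_inv_atTop_zero (𝕜 := ℝ))
      simpa [Function.comp_def] using this
    have l := ((hinv.mul_const (b n : ℂ)).const_sub I).add
      (((hinv.pow 2).mul (HT n).2).const_mul ((a (n - 1) ^ 2 : ℝ) : ℂ))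
    have l2 := l.div_const ((a n ^ 2 : ℝ) : ℂ)
    have e : (I - 0 * (b n : ℂ) + ((a (n - 1) ^ 2 : ℝ) : ℂ) * (0 ^ 2 * I)) / ((a n ^ 2 : ℝ) : ℂ) =
        ((1 / a n ^ 2 : ℝ) : ℂ) * I := by
      push_cast
      ring
    rw [e] at l2
    refine l2.congr' ?_
    filter_upwards [eventually_gt_atTop 0] with s hs
    have hs' : (s : ℂ) ≠ 0 := by exact_mod_cast hs.ne'
    have := hac n
    rw [HMT n _ (by simpa using hs)]
    push_cast
    field_simp
  have R1 : ∀ n (z : ℂ), 0 < z.im →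
      -1 / mP n z = z - (b (n + 1) : ℝ) + ((a (n + 1) ^ 2 : ℝ) : ℂ) * mP (n + 1) z := by
    intro n z hz
    have h1 := fpne z hz n
    have h1' := fpne z hz (n + 1)
    have h2 := hac n
    have h3 := hac (n + 1)
    have h4 := fps z hz (n + 1)
    rw [add_sub_cancel_right] at h4
    simp only [hmP]
    push_cast
    field_simp
    linear_combination h4
  have R2 : ∀ n (z : ℂ), 0 < z.im →
      -1 / mM n z = -(z - (b (n + 1) : ℝ)) + ((a (n + 1) ^ 2 : ℝ) : ℂ) * mM (n + 1) z := by
    intro n z hz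
    have h1 := fmne z hz n
    have h1' := fmne z hz (n + 1)
    have h2 := hac n
    have h3 := hac (n + 1)
    have h4 := fms z hz (n + 1)
    rw [add_sub_cancel_right] at h4
    simp only [hmM]
    push_cast
    field_simp
    linear_combination -h4
  have hA : ∀ n, 0 < a n ^ 2 := fun n => by have := hpos n; positivity
  have E : ∀ n, HasExt (mP n) (mM n) := by
    intro n
    induction n using Int.induction_on with
    | zero =>
      apply hasExt_of_reflectionless (HP 0).1 (HM 0)
      filter_upwards [hr] with x hx hx2
      refine (hx hx2).congr' ?_
      filter_upwards [self_mem_nhdsWithin] with y hy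
      have hy' : 0 < ((x : ℂ) + y * I).im := by simpa using hy
      rw [hmp _ hy', hmm _ hy']
      simp only [hmP, hmM, zero_add]
    | succ i ih =>
      exact hasExt_succ (hA _) (HP _).1.2 (HM _).2 (R1 i) (R2 i) ih
    | pred i ih =>
      have r1 := R1 (-(i : ℤ) - 1)
      have r2 := R2 (-(i : ℤ) - 1)
      rw [sub_add_cancel] at r1 r2
      exact hasExt_pred (hA _) (HP _).1.2 (HM _).2 r1 r2 ih
  have site := fun n => site_lemma (B := 1 / a n ^ 2) (by have := hA n; positivity) (E n) (HP n).2
    (HM2 n)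
  have one_le : ∀ n, 1 ≤ a n := by
    intro n
    have h := (site n).1
    rw [div_le_one (hA n)] at h
    have := hpos n
    nlinarith
  refine ⟨one_le, ?_⟩
  rintro ⟨n₀, h0⟩
  have sq1 : ∀ n, a n ^ 2 = 1 → a n = 1 := by
    intro n h
    have := one_le n
    nlinarith
  have right : ∀ n, a n = 1 → a (n + 1) = 1 := by
    intro n hn
    have h := ((site n).2 (by rw [hn]; norm_num)).1
    have := coeff_of_free (β := b (n + 1)) (A := a (n + 1) ^ 2) (HP (n + 1)).2 (fun R hR => by
      have hR0 : 0 < R := by linarith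
      have hz : 0 < R - 1 / R := by
        have : 1 / R < 1 := by rw [div_lt_one hR0]; exact hR
        linarith
      have e := h (1 / R) (by positivity) (by rw [div_lt_one hR0]; exact hR)
      rw [one_div_one_div] at e
      rw [← R1 n _ (by rw [Complex.im_ofReal_mul]; simpa using hz), e]
      have hRc : (R : ℂ) ≠ 0 := by exact_mod_cast hR0.ne'
      push_cast
      field_simp
      rw [I_sq])
    exact sq1 _ this.2
  have left : ∀ n, a n = 1 → b n = 0 ∧ a (n - 1) = 1 := by
    intro n hn
    have h := ((site n).2 (by rw [hn]; norm_num)).2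
    have := coeff_of_free (β := b n) (A := a (n - 1) ^ 2) (HT n).2 (fun R hR => by
      have hR0 : 0 < R := by linarith
      have hz : 0 < R - 1 / R := by
        have : 1 / R < 1 := by rw [div_lt_one hR0]; exact hR
        linarith
      rw [← h R hR, HMT n _ (by rw [Complex.im_ofReal_mul]; simpa using hz), hn]
      simp)
    exact ⟨this.1, sq1 _ this.2⟩
  have all : ∀ k : ℤ, a (n₀ + k) = 1 := by
    intro k
    induction k using Int.induction_on with
    | zero => simpa using h0
    | succ i ih => rw [← add_assoc]; exact right _ ih
    | pred i ih => rw [← add_sub_assoc]; exact (left _ ih).2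
  intro n
  have hn : a n = 1 := by have := all (n - n₀); rwa [add_sub_cancel] at this
  exact ⟨hn, (left n hn).1⟩
end
end

section
/- Let R ≥ 2, let J ∈ M_R (a whole-line Jacobi matrix with ‖J‖ ≤ R, reflectionless on (−2,2)) with coefficients a_n, b_n, and let σ be the finite measure on (−1/r,−r) ∪ (r,1/r) representing its F function via F(λ) = −σ_{−1} + (1 − σ_{−2})λ + ∫ dσ(t)/(t − λ). Then σ_{−2} = 1 − 1/a_0² (equivalently a_0 = (1 − σ_{−2})^{−1/2}), b_0 = −σ_{−1}/(1 − σ_{−2}), and σ_0 = (a_{−1}² − 1)/a_0². -/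
open MeasureTheory Complex Filter Set

noncomputable section

abbrev L2Z := lp (fun _ : ℤ => ℂ) 2

def dlt (n : ℤ) : L2Z := lp.single 2 n (1 : ℂ)

lemma inner_dlt (n : ℤ) (u : L2Z) : inner ℂ (dlt n) u = u n := by
  simp [dlt, lp.inner_single_left]

lemma dlt_apply (n m : ℤ) : (dlt n : L2Z) m = if m = n then 1 else 0 := by
  simp [dlt, lp.single_apply, Pi.single_apply]

lemma jacobi_selfAdjoint (a b : ℤ → ℝ) (T : L2Z →L[ℂ] L2Z) (hT : IsJacobiOperator a b T) :
    IsSelfAdjoint T := by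
  rw [ContinuousLinearMap.isSelfAdjoint_iff']
  ext u n
  rw [← inner_dlt n, ContinuousLinearMap.adjoint_inner_right]
  have h : T (dlt n) = (a (n-1) : ℂ) • dlt (n-1) + (a n : ℂ) • dlt (n+1) + (b n : ℂ) • dlt n := by
    ext m
    rw [hT]
    simp only [lp.coeFn_add, lp.coeFn_smul, Pi.add_apply, Pi.smul_apply, dlt_apply, smul_eq_mul]
    by_cases h1 : m = n
    · subst h1; simp; intro h; omega
    by_cases h2 : m = n + 1
    · have h4 : ¬ (m + 1 = n) := by omega
      have h5 : m - 1 = n := by omega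
      have h6 : ¬ (m = n - 1) := by omega
      simp only [if_neg h1, if_pos h2, if_neg h4, if_pos h5, if_neg h6]
      simp [← h5]
    by_cases h3 : m = n - 1
    · have h4 : m + 1 = n := by omega
      have h5 : ¬ (m - 1 = n) := by omega
      simp only [if_neg h1, if_neg h2, if_pos h4, if_neg h5, if_pos h3]
      simp [h3]
    have h4 : ¬ (m + 1 = n) := by omega
    have h5 : ¬ (m - 1 = n) := by omega
    simp [h1, h2, h3, h4, h5]
  rw [h, hT]
  simp only [inner_add_left, inner_smul_left, inner_dlt, Complex.conj_ofReal]
  ring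

/-- truncation to a half line -/
lemma trunc_neg (f : ℤ → ℂ) (hf : SquareSummableAtBot f) :
    ∃ u : L2Z, ∀ n : ℤ, u n = if n ≤ -1 then f n else 0 := by
  refine ⟨⟨fun n => if n ≤ -1 then f n else 0, ?_⟩, fun n => rfl⟩
  apply memℓp_gen
  simp only [ENNReal.toReal_ofNat, Real.rpow_ofNat]
  rw [summable_int_iff_summable_nat_and_neg]
  constructor
  · convert summable_zero with n
    have : ¬ ((n:ℤ) ≤ -1) := by omega
    simp [this]
  · refine Summable.of_nonneg_of_le (fun n => by positivity) (fun n => ?_) hf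
    split_ifs <;> simp

lemma trunc_pos (f : ℤ → ℂ) (hf : SquareSummableAtTop f) :
    ∃ u : L2Z, ∀ n : ℤ, u n = if 1 ≤ n then f n else 0 := by
  refine ⟨⟨fun n => if 1 ≤ n then f n else 0, ?_⟩, fun n => rfl⟩
  apply memℓp_gen
  simp only [ENNReal.toReal_ofNat, Real.rpow_ofNat]
  rw [summable_int_iff_summable_nat_and_neg]
  constructor
  · refine Summable.of_nonneg_of_le (fun n => by positivity) (fun n => ?_) hf
    split_ifs <;> simp
  · convert summable_zero with n
    have : ¬ (1 ≤ -(n:ℤ)) := by omega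
    simp [this]

lemma sa_im (A : L2Z →L[ℂ] L2Z) (hA : IsSelfAdjoint A) (u : L2Z) :
    (inner ℂ u (A u)).im = 0 := by
  have := (ContinuousLinearMap.isSelfAdjoint_iff_isSymmetric.mp hA).im_inner_self_apply u
  simpa using this

lemma inner_self_of (u : L2Z) : inner ℂ u u = ((‖u‖^2 : ℝ) : ℂ) := by
  rw [inner_self_eq_norm_sq_to_K]; norm_cast

/-- uniqueness of m₊ -/
lemma mplus_unique (a b : ℤ → ℝ) (ha : ∀ n, 0 < a n) (T : L2Z →L[ℂ] L2Z)
    (hT : IsJacobiOperator a b T) (m m' : ℂ → ℂ) (hm : IsJacobiMPlus a b m)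
    (hm' : IsJacobiMPlus a b m') (z : ℂ) (hz : 0 < z.im) : m z = m' z := by
  obtain ⟨f, hf, hfs, hf0, hfm⟩ := hm z hz
  obtain ⟨g, hg, hgs, hg0, hgm⟩ := hm' z hz
  obtain ⟨u, hu⟩ := trunc_pos f hfs
  obtain ⟨v, hv⟩ := trunc_pos g hgs
  set w : L2Z := (g 0) • u - (f 0) • v with hw
  have hwn : ∀ n, w n = g 0 * u n - f 0 * v n := fun n => by
    simp only [hw, lp.coeFn_sub, lp.coeFn_smul, Pi.sub_apply, Pi.smul_apply, smul_eq_mul]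
  have key : T w = z • w + ((a 0 : ℂ) * w 1) • dlt 0 := by
    ext n
    rw [hT]
    simp only [lp.coeFn_add, lp.coeFn_smul, Pi.add_apply, Pi.smul_apply, dlt_apply, smul_eq_mul,
      hwn, hu, hv]
    rcases lt_trichotomy n 0 with h | h | h
    · have h1 : ¬ (1 ≤ n + 1) := by omega
      have h2 : ¬ (1 ≤ n - 1) := by omega
      have h3 : ¬ (1 ≤ n) := by omega
      have h4 : ¬ (n = 0) := by omega
      simp [h1, h2, h3, h4]
    · subst h; simp
    · have h1 : 1 ≤ n + 1 := by omega
      have h3 : 1 ≤ n := by omega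
      have h4 : n ≠ 0 := by omega
      have e1 := hf n
      have e2 := hg n
      simp only [h1, h3, h4, if_true, if_false]
      by_cases h2 : 1 ≤ n - 1
      · simp only [h2, if_true]
        linear_combination g 0 * e1 - f 0 * e2
      · have : n = 1 := by omega
        subst this
        simp at e1 e2 ⊢
        linear_combination g 0 * e1 - f 0 * e2
  have h0 : inner ℂ w (dlt 0) = 0 := by
    rw [← inner_conj_symm, inner_dlt, hwn, hu, hv]; simp
  have him := sa_im T (jacobi_selfAdjoint a b T hT) w
  rw [key, inner_add_right, inner_smul_right, inner_smul_right, h0, inner_self_of] at him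
  simp only [mul_zero, add_zero, Complex.im_mul_ofReal] at him
  have hw0 : w = 0 := by
    rcases mul_eq_zero.mp him with h | h
    · exact absurd h hz.ne'
    · simpa using h
  have h1 : w 1 = 0 := by rw [hw0]; simp
  rw [hwn, hu, hv] at h1
  simp at h1
  have ha0 : (a 0 : ℂ) ≠ 0 := by exact_mod_cast (ha 0).ne'
  rw [hfm, hgm]
  field_simp
  linear_combination -h1

lemma mminus_formula (a b : ℤ → ℝ) (ha : ∀ n, 0 < a n) (T : L2Z →L[ℂ] L2Z)
    (hT : IsJacobiOperator a b T) : ∃ (g : ℂ → ℂ) (K : ℝ),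
      DifferentiableOn ℂ g {z : ℂ | 0 < z.im} ∧ (∀ z : ℂ, 0 < z.im → 0 ≤ (g z).im) ∧
      (∀ z : ℂ, 0 < z.im → ‖z * g z + 1‖ ≤ K / z.im) ∧
      ∀ m, IsJacobiMMinus a b m → ∀ z : ℂ, 0 < z.im →
        m z = (z - b 0 + (a (-1) : ℂ)^2 * g z) / (a 0 : ℂ)^2 := by
  set P : L2Z →L[ℂ] L2Z := InnerProductSpace.rankOne ℂ (dlt (-1)) (dlt 0) with hP
  set Q : L2Z →L[ℂ] L2Z := InnerProductSpace.rankOne ℂ (dlt 0) (dlt (-1)) with hQ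
  set A : L2Z →L[ℂ] L2Z := T - (a (-1) : ℂ) • (P + Q) with hA
  have hAsa : IsSelfAdjoint A := by
    have h1 := jacobi_selfAdjoint a b T hT
    rw [ContinuousLinearMap.isSelfAdjoint_iff'] at h1 ⊢
    rw [hA, map_sub, h1, LinearIsometryEquiv.map_smulₛₗ, map_add, hP, hQ]
    simp only [InnerProductSpace.adjoint_rankOne, Complex.conj_ofReal]
    rw [add_comm]
  have hAu : ∀ u : L2Z, A u = T u - (a (-1) : ℂ) • ((u 0) • dlt (-1) + (u (-1)) • dlt 0) := by
    intro u
    have e1 : P u = (u 0) • dlt (-1) := by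
      rw [hP, InnerProductSpace.rankOne_apply, inner_dlt]
    have e2 : Q u = (u (-1)) • dlt 0 := by
      rw [hQ, InnerProductSpace.rankOne_apply, inner_dlt]
    rw [hA, sub_apply, smul_apply, add_apply, e1, e2]
  have hres : ∀ z : ℂ, 0 < z.im → z ∈ resolventSet ℂ A := by
    intro z hz
    by_contra h
    have := hAsa.mem_spectrum_eq_re (z := z) h
    have := congrArg Complex.im this
    simp at this
    exact hz.ne' this
  -- v z = (z - A)^{-1} δ
  set v : ℂ → L2Z := fun z => resolvent A z (dlt (-1)) with hv
  have hveq : ∀ z : ℂ, 0 < z.im → z • v z - A (v z) = dlt (-1) := by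
    intro z hz
    have h := Ring.mul_inverse_cancel _ (hres z hz)
    have := congrArg (fun S : L2Z →L[ℂ] L2Z => S (dlt (-1))) h
    simpa [hv, resolvent, Algebra.algebraMap_eq_smul_one] using this
  have hvuniq : ∀ z : ℂ, 0 < z.im → ∀ (w : L2Z) (c : ℂ), z • w - A w = c • dlt (-1) → w = c • v z := by
    intro z hz w c h
    have h2 := Ring.inverse_mul_cancel _ (hres z hz)
    have h3 : (algebraMap ℂ (L2Z →L[ℂ] L2Z) z - A) w = c • dlt (-1) := by
      rw [← h]; simp [Algebra.algebraMap_eq_smul_one]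
    have h4 : (Ring.inverse (algebraMap ℂ (L2Z →L[ℂ] L2Z) z - A))
        ((algebraMap ℂ (L2Z →L[ℂ] L2Z) z - A) w) = w :=
      congrArg (fun S : L2Z →L[ℂ] L2Z => S w) h2
    rw [h3, map_smul] at h4
    exact h4.symm
  have hd1 : ‖dlt (-1)‖ = 1 := by
    rw [dlt, lp.norm_single (by norm_num)]; simp
  have hvim : ∀ z : ℂ, 0 < z.im → (v z (-1)).im = - (z.im * ‖v z‖^2) := by
    intro z hz
    have h1 := congrArg (fun w => (inner ℂ (v z) w).im) (hveq z hz)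
    simp only [inner_sub_right, inner_smul_right, Complex.sub_im, sa_im A hAsa,
      inner_self_of, Complex.im_mul_ofReal] at h1
    rw [← inner_conj_symm, inner_dlt] at h1
    simp only [Complex.conj_im] at h1
    linarith
  have hvnorm : ∀ z : ℂ, 0 < z.im → ‖v z‖ ≤ 1 / z.im := by
    intro z hz
    have h1 := hvim z hz
    have h2 : ‖v z (-1)‖ ≤ ‖v z‖ := lp.norm_apply_le_norm (by norm_num) _ _
    have h3 := (abs_le.mp (Complex.abs_im_le_norm (v z (-1)))).1
    rw [le_div_iff₀ hz]
    rcases (norm_nonneg (v z)).eq_or_lt with h | h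
    · rw [← h]; simp
    · have : ‖v z‖ * (z.im * ‖v z‖) ≤ ‖v z‖ * 1 := by nlinarith
      have := le_of_mul_le_mul_left this h
      linarith
  refine ⟨fun z => - (v z (-1)), ‖A‖, ?_, ?_, ?_, ?_⟩
  · intro z hz
    have h1 := (spectrum.hasDerivAt_resolvent_const_left (hres z hz)).differentiableAt
    have h2 : (fun z => - (v z (-1))) =
        fun z => - (innerSL ℂ (dlt (-1)) (resolvent A z (dlt (-1)))) := by
      funext z; simp [hv, inner_dlt]
    rw [h2]
    have h3 : DifferentiableAt ℂ (fun z => resolvent A z (dlt (-1))) z :=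
      h1.clm_apply (differentiableAt_const _)
    exact (((innerSL ℂ (dlt (-1))).differentiableAt.comp z h3).neg).differentiableWithinAt
  · intro z hz
    have := hvim z hz
    have : 0 ≤ z.im * ‖v z‖^2 := by positivity
    simp only [Complex.neg_im]; linarith
  · intro z hz
    have h1 := congrArg (fun w : L2Z => w (-1)) (hveq z hz)
    simp only [lp.coeFn_sub, lp.coeFn_smul, Pi.sub_apply, Pi.smul_apply, dlt_apply, smul_eq_mul,
      if_true] at h1
    have h2 : z * -(v z (-1)) + 1 = - (A (v z) (-1)) := by linear_combination -h1
    rw [h2, norm_neg]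
    calc ‖A (v z) (-1)‖ ≤ ‖A (v z)‖ := lp.norm_apply_le_norm (by norm_num) _ _
      _ ≤ ‖A‖ * ‖v z‖ := A.le_opNorm _
      _ ≤ ‖A‖ * (1 / z.im) := by gcongr; exact hvnorm z hz
      _ = ‖A‖ / z.im := by ring
  · intro m hm z hz
    obtain ⟨f, hf, hfs, hf0, hfm⟩ := hm z hz
    obtain ⟨u, hu⟩ := trunc_neg f hfs
    have h1 : z • u - A u = ((a (-1) : ℂ) * f 0) • dlt (-1) := by
      have hT' : ∀ u : L2Z, ∀ n : ℤ, T u n =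
        (a n : ℂ) * u (n + 1) + (a (n - 1) : ℂ) * u (n - 1) + (b n : ℂ) * u n := hT
      rw [hAu]
      ext n
      simp only [lp.coeFn_add, lp.coeFn_sub, lp.coeFn_smul, Pi.sub_apply, Pi.add_apply,
        Pi.smul_apply, dlt_apply, smul_eq_mul, hT', hu]
      have e := hf n
      by_cases h1 : n ≤ -2
      · have h2 : n + 1 ≤ -1 := by omega
        have h3 : n - 1 ≤ -1 := by omega
        have h4 : n ≤ -1 := by omega
        have h5 : n ≠ -1 := by omega
        have h6 : n ≠ 0 := by omega
        simp only [h2, h3, h4, h5, h6, if_true, if_false]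
        linear_combination -e
      by_cases h2 : n = -1
      · subst h2
        simp at e ⊢
        linear_combination -e
      by_cases h3 : n = 0
      · subst h3
        simp
      have h2 : ¬ (n + 1 ≤ -1) := by omega
      have h3' : ¬ (n - 1 ≤ -1) := by omega
      have h4 : ¬ (n ≤ -1) := by omega
      have h5 : n ≠ -1 := by omega
      simp only [h2, h3', h4, h5, h3, if_false]
      simp
    have h2 := hvuniq z hz u _ h1
    have h3 := congrArg (fun w : L2Z => w (-1)) h2
    simp only [lp.coeFn_smul, Pi.smul_apply, smul_eq_mul, hu] at h3
    simp at h3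
    have e := hf 0
    simp at e
    have ha0 : (a 0 : ℂ) ≠ 0 := by exact_mod_cast (ha 0).ne'
    rw [hfm]
    field_simp
    rw [h3] at e
    linear_combination e

lemma kint_ne (s : ℝ) (hs : 0 < s) :
    (∫ x in (-s)..s, ((x:ℂ) - s * I)⁻¹) ≠ 0 := by
  have hne : ∀ x : ℝ, (x:ℂ) - s * I ≠ 0 := fun x h => by
    have := congrArg Complex.im h; simp at this; exact hs.ne' this
  have hc : Continuous fun x : ℝ => ((x:ℂ) - s * I)⁻¹ :=
    Continuous.inv₀ (by fun_prop) hne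
  intro h
  have h1 := intervalIntegral.intervalIntegral_pos_of_pos
    (f := fun x : ℝ => (((x:ℂ) - s * I)⁻¹).im) (a := -s) (b := s)
    ((Complex.continuous_im.comp hc).intervalIntegrable _ _)
    (fun x => by
      simp only [Complex.inv_im]
      have := Complex.normSq_pos.mpr (hne x)
      have h2 : ((x:ℂ) - s * I).im = -s := by simp
      rw [h2, neg_neg]
      positivity) (by linarith)
  have h2 := Complex.imCLM.intervalIntegral_comp_comm (hc.intervalIntegrable (μ := volume) (-s) s)
  simp only [Complex.imCLM_apply] at h2
  rw [h2, h] at h1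
  simp at h1

/-- Cauchy on a square for a function invariant under rotation by `I`. -/
lemma square_cauchy (h : ℂ → ℂ) (s ε : ℝ) (hs : 0 < s) (hε : 0 < ε)
    (hd : DifferentiableOn ℂ h (Ioo (-(s+ε)) (s+ε) ×ℂ Ioo (-(s+ε)) (s+ε)))
    (hrot : ∀ w, h (I * w) = h w) :
    h 0 * (∫ x in (-s)..s, ((x:ℂ) - s * I)⁻¹) =
      ∫ x in (-s)..s, h ((x:ℂ) - s * I) * ((x:ℂ) - s * I)⁻¹ := by
  have hne : ∀ x : ℝ, (x:ℂ) - s * I ≠ 0 := fun x h => by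
    have := congrArg Complex.im h; simp at this; exact hs.ne' this
  have hinv : Continuous fun x : ℝ => ((x:ℂ) - s * I)⁻¹ :=
    Continuous.inv₀ (by fun_prop) hne
  have hopen : IsOpen (Ioo (-(s+ε)) (s+ε) ×ℂ Ioo (-(s+ε)) (s+ε)) :=
    isOpen_Ioo.reProdIm isOpen_Ioo
  have hk : DifferentiableOn ℂ (dslope h 0) (Ioo (-(s+ε)) (s+ε) ×ℂ Ioo (-(s+ε)) (s+ε)) := by
    rw [Complex.differentiableOn_dslope]
    · exact hd
    · apply hopen.mem_nhds
      simp [Complex.mem_reProdIm]; constructor <;> linarith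
  have hsub : uIcc (-s) s ×ℂ uIcc (-s) s ⊆ Ioo (-(s+ε)) (s+ε) ×ℂ Ioo (-(s+ε)) (s+ε) := by
    intro w hw
    rw [uIcc_of_le (by linarith)] at hw
    simp only [Complex.mem_reProdIm, mem_Icc, mem_Ioo] at hw ⊢
    obtain ⟨⟨h1, h2⟩, h3, h4⟩ := hw
    refine ⟨⟨?_, ?_⟩, ?_, ?_⟩ <;> linarith
  have hkrot : ∀ w, w ≠ 0 → dslope h 0 (I * w) = -I * dslope h 0 w := by
    intro w hw
    have : I * w ≠ 0 := mul_ne_zero Complex.I_ne_zero hw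
    rw [dslope_of_ne _ this, dslope_of_ne _ hw, slope_def_field, slope_def_field, hrot]
    rw [sub_zero, sub_zero, div_eq_iff this]
    field_simp
    linear_combination (h w - h 0) * Complex.I_sq
  have hrect := Complex.integral_boundary_rect_eq_zero_of_differentiableOn (dslope h 0)
    (⟨-s, -s⟩ : ℂ) (⟨s, s⟩ : ℂ) (hk.mono hsub)
  simp only at hrect
  set B := ∫ x in (-s)..s, dslope h 0 ((x:ℂ) - s * I) with hB
  have e1 : (∫ x in (-s)..s, dslope h 0 ((x:ℂ) + ((-s:ℝ):ℂ) * I)) = B := by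
    rw [hB]; congr 1; funext x; congr 1; push_cast; ring
  have e2 : (∫ y in (-s)..s, dslope h 0 ((s:ℂ) + (y:ℂ) * I)) = -I * B := by
    rw [hB, ← intervalIntegral.integral_const_mul]; congr 1; funext y
    rw [← hkrot _ (hne y)]; congr 1; linear_combination (s:ℂ) * Complex.I_sq
  have e3 : (∫ x in (-s)..s, dslope h 0 ((x:ℂ) + (s:ℂ) * I)) = - B := by
    have : ∀ x : ℝ, dslope h 0 ((x:ℂ) + (s:ℂ) * I) =
        - dslope h 0 ((((-x):ℝ):ℂ) - s * I) := by
      intro x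
      have e := hkrot _ (mul_ne_zero Complex.I_ne_zero (hne (-x)))
      rw [hkrot _ (hne (-x))] at e
      have e' : (x:ℂ) + (s:ℂ) * I = I * (I * ((((-x):ℝ):ℂ) - s * I)) := by
        push_cast; linear_combination ((x:ℂ) + s * I) * Complex.I_sq
      rw [e', e]
      linear_combination dslope h 0 ((((-x):ℝ):ℂ) - s * I) * Complex.I_sq
    simp_rw [this]
    rw [intervalIntegral.integral_neg,
      intervalIntegral.integral_comp_neg (fun x : ℝ => dslope h 0 ((x:ℂ) - s * I)), neg_neg]
  have e4 : (∫ y in (-s)..s, dslope h 0 (((-s:ℝ):ℂ) + (y:ℂ) * I)) = I * B := by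
    have : ∀ y : ℝ, dslope h 0 (((-s:ℝ):ℂ) + (y:ℂ) * I) =
        I * dslope h 0 ((((-y):ℝ):ℂ) - s * I) := by
      intro y
      have n0 := hne (-y)
      have n1 := mul_ne_zero Complex.I_ne_zero n0
      have n2 := mul_ne_zero Complex.I_ne_zero n1
      have e := hkrot _ n2
      rw [hkrot _ n1, hkrot _ n0] at e
      have e' : ((-s:ℝ):ℂ) + (y:ℂ) * I = I * (I * (I * ((((-y):ℝ):ℂ) - s * I))) := by
        push_cast
        linear_combination ((y:ℂ) * I + s * (I ^ 2 - 1)) * Complex.I_sq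
      rw [e', e]
      linear_combination -I * dslope h 0 ((((-y):ℝ):ℂ) - s * I) * Complex.I_sq
    simp_rw [this]
    rw [intervalIntegral.integral_const_mul,
      intervalIntegral.integral_comp_neg (fun x : ℝ => dslope h 0 ((x:ℂ) - s * I)), neg_neg]
  rw [e1, e2, e3, e4] at hrect
  have hB0 : B = 0 := by
    simp only [smul_eq_mul] at hrect
    have : 4 * B = 0 := by linear_combination hrect + 2 * B * Complex.I_sq
    simpa using this
  have hcont : ContinuousOn (fun x : ℝ => h ((x:ℂ) - s * I)) (uIcc (-s) s) := by
    refine (hd.continuousOn.mono hsub).comp (by fun_prop) ?_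
    intro x hx
    rw [uIcc_of_le (by linarith)] at hx ⊢
    simpa [Complex.mem_reProdIm, hs.le] using hx
  have i1 : IntervalIntegrable (fun x : ℝ => h ((x:ℂ) - s * I) * ((x:ℂ) - s * I)⁻¹) volume (-s) s :=
    (hcont.mul hinv.continuousOn).intervalIntegrable
  have i2 : IntervalIntegrable (fun x : ℝ => h 0 * ((x:ℂ) - s * I)⁻¹) volume (-s) s :=
    (continuous_const.mul hinv).intervalIntegrable _ _
  have : B = (∫ x in (-s)..s, h ((x:ℂ) - s * I) * ((x:ℂ) - s * I)⁻¹) -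
      ∫ x in (-s)..s, h 0 * ((x:ℂ) - s * I)⁻¹ := by
    rw [← intervalIntegral.integral_sub i1 i2, hB]
    congr 1; funext x
    rw [dslope_of_ne _ (hne x), slope_def_field, sub_zero]
    ring
  rw [hB0, intervalIntegral.integral_const_mul] at this
  linear_combination this

lemma boundary_unique_aux (D : ℂ → ℂ) (C : ℝ)
    (hD : DifferentiableOn ℂ D {z : ℂ | 0 < z.im}) (hC : ∀ z : ℂ, 0 < z.im → ‖D z‖ ≤ C)
    (hlim : ∀ᵐ x : ℝ, x ∈ Ioo (-2:ℝ) 2 →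
      Tendsto (fun y : ℝ => D (↑x + ↑y * I)) (nhdsWithin 0 (Ioi 0)) (nhds 0))
    (s : ℝ) (hs : 0 < s) (hs2 : s < 2) : D (s * I) = 0 := by
  have hC0 : 0 ≤ C := (norm_nonneg _).trans (hC I (by simp))
  have hne : ∀ x : ℝ, (x:ℂ) - s * I ≠ 0 := fun x h => by
    have := congrArg Complex.im h; simp at this; exact hs.ne' this
  have hinv : Continuous fun x : ℝ => ((x:ℂ) - s * I)⁻¹ :=
    Continuous.inv₀ (by fun_prop) hne
  set G : ℝ → ℂ → ℂ := fun ε w => D (s * I + ε * I + w) with hG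
  set h : ℝ → ℂ → ℂ := fun ε w => G ε w * G ε (I * w) * G ε (-w) * G ε (-(I * w)) with hh
  have hrot : ∀ ε w, h ε (I * w) = h ε w := by
    intro ε w
    simp only [hh]
    have : I * (I * w) = -w := by linear_combination w * Complex.I_sq
    rw [this, neg_neg]; ring
  have hdG : ∀ ε : ℝ, 0 < ε → ∀ w : ℂ, -(s+ε) < w.im → DifferentiableAt ℂ (G ε) w := by
    intro ε hε w hw
    have h1 : DifferentiableAt ℂ D (s * I + ε * I + w) := by
      apply hD.differentiableAt
      apply (isOpen_lt continuous_const Complex.continuous_im).mem_nhds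
      simp; linarith
    exact h1.comp w (by fun_prop)
  have hbG : ∀ ε : ℝ, 0 < ε → ∀ w : ℂ, -(s+ε) < w.im → ‖G ε w‖ ≤ C := by
    intro ε hε w hw
    apply hC
    simp; linarith
  have hdh : ∀ ε : ℝ, 0 < ε →
      DifferentiableOn ℂ (h ε) (Ioo (-(s+ε)) (s+ε) ×ℂ Ioo (-(s+ε)) (s+ε)) := by
    intro ε hε w hw
    simp only [Complex.mem_reProdIm, mem_Ioo] at hw
    obtain ⟨⟨h1, h2⟩, h3, h4⟩ := hw
    apply DifferentiableAt.differentiableWithinAt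
    have d1 := hdG ε hε w h3
    have d2 : DifferentiableAt ℂ (fun w => G ε (I * w)) w :=
      (hdG ε hε (I * w) (by simpa using h1)).comp w (by fun_prop)
    have d3 : DifferentiableAt ℂ (fun w => G ε (-w)) w :=
      (hdG ε hε (-w) (by simp only [Complex.neg_im]; linarith)).comp w (by fun_prop)
    have d4 : DifferentiableAt ℂ (fun w => G ε (-(I * w))) w :=
      DifferentiableAt.comp (g := G ε) (f := fun w => -(I * w)) w
        (hdG ε hε (-(I * w)) (by simp; linarith)) (by fun_prop)
    exact ((d1.mul d2).mul d3).mul d4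
  have hbh : ∀ ε : ℝ, 0 < ε → ∀ x ∈ Ioc (-s) s, ‖h ε ((x:ℂ) - s * I)‖ ≤
      ‖D (↑x + ↑ε * I)‖ * C^3 := by
    intro ε hε x hx
    have b1 : G ε ((x:ℂ) - s * I) = D (↑x + ↑ε * I) := by
      simp only [hG]; congr 1; ring
    have b2 := hbG ε hε (I * ((x:ℂ) - s * I)) (by simp; linarith [hx.1])
    have b3 := hbG ε hε (-((x:ℂ) - s * I)) (by simp; linarith [hx.1])
    have b4 := hbG ε hε (-(I * ((x:ℂ) - s * I))) (by simp; linarith [hx.2])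
    simp only [hh, norm_mul]
    rw [b1]
    have : ‖D (↑x + ↑ε * I)‖ * C^3 = ‖D (↑x + ↑ε * I)‖ * C * C * C := by ring
    rw [this]
    gcongr
  have hpos : ∀ᶠ ε : ℝ in nhdsWithin 0 (Ioi 0), 0 < ε := self_mem_nhdsWithin
  have hu : uIoc (-s) s = Ioc (-s) s := uIoc_of_le (by linarith)
  have hT : Tendsto (fun ε : ℝ => ∫ x in (-s)..s, h ε ((x:ℂ) - s * I) * ((x:ℂ) - s * I)⁻¹)
      (nhdsWithin 0 (Ioi 0)) (nhds (∫ x in (-s)..s, (0:ℂ))) := by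
    apply intervalIntegral.tendsto_integral_filter_of_dominated_convergence
      (fun x => C * C^3 * ‖((x:ℂ) - s * I)⁻¹‖)
    · filter_upwards [hpos] with ε hε
      apply ContinuousOn.aestronglyMeasurable _ measurableSet_uIoc
      refine ContinuousOn.mul ?_ hinv.continuousOn
      refine (hdh ε hε).continuousOn.comp (by fun_prop) ?_
      intro x hx
      rw [hu] at hx
      simp only [Complex.mem_reProdIm, mem_Ioo]
      simp
      refine ⟨⟨?_, ?_⟩, ?_, ?_⟩ <;> linarith [hx.1, hx.2]
    · filter_upwards [hpos] with ε hε
      refine Eventually.of_forall fun x hx => ?_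
      rw [hu] at hx
      rw [norm_mul]
      gcongr
      refine (hbh ε hε x hx).trans ?_
      gcongr
      exact hC _ (by simp [hε])
    · exact (continuous_const.mul hinv.norm).intervalIntegrable _ _
    · filter_upwards [hlim] with x hx hxs
      rw [hu] at hxs
      have h1 := hx ⟨by linarith [hxs.1], by linarith [hxs.2]⟩
      have h2 : Tendsto (fun ε : ℝ => h ε ((x:ℂ) - s * I)) (nhdsWithin 0 (Ioi 0)) (nhds 0) := by
        apply squeeze_zero_norm' (a := fun ε : ℝ => ‖D (↑x + ↑ε * I)‖ * C^3)
        · filter_upwards [hpos] with ε hε using hbh ε hε x hxs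
        · simpa using h1.norm.mul_const (C^3)
      simpa using h2.mul_const ((x:ℂ) - s * I)⁻¹
  have hT2 : Tendsto (fun ε : ℝ => h ε 0 * (∫ x in (-s)..s, ((x:ℂ) - s * I)⁻¹))
      (nhdsWithin 0 (Ioi 0)) (nhds 0) := by
    have h0 : (∫ x in (-s)..s, (0:ℂ)) = 0 := by simp
    rw [h0] at hT
    refine hT.congr' ?_
    filter_upwards [hpos] with ε hε
    exact (square_cauchy (h ε) s ε hs hε (hdh ε hε) (hrot ε)).symm
  have hcD : ContinuousAt D (s * I) := by
    apply (hD.differentiableAt _).continuousAt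
    apply (isOpen_lt continuous_const Complex.continuous_im).mem_nhds
    simpa using hs
  have hT3 : Tendsto (fun ε : ℝ => h ε 0 * (∫ x in (-s)..s, ((x:ℂ) - s * I)⁻¹))
      (nhdsWithin 0 (Ioi 0))
      (nhds (D (s*I) * D (s*I) * D (s*I) * D (s*I) * (∫ x in (-s)..s, ((x:ℂ) - s * I)⁻¹))) := by
    have t1 : Tendsto (fun ε : ℝ => (s:ℂ) * I + ε * I) (nhdsWithin 0 (Ioi 0)) (nhds (s * I)) := by
      have : Continuous (fun ε : ℝ => (s:ℂ) * I + ε * I) := by fun_prop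
      have := this.tendsto 0
      simp only [Complex.ofReal_zero, zero_mul, add_zero] at this
      exact this.mono_left nhdsWithin_le_nhds
    have t2 := hcD.tendsto.comp t1
    simp only [hh, hG, mul_zero, neg_zero, add_zero]
    exact (((t2.mul t2).mul t2).mul t2).mul_const _
  have := tendsto_nhds_unique hT3 hT2
  simpa [kint_ne s hs] using this

lemma boundary_unique (D : ℂ → ℂ) (C : ℝ)
    (hD : DifferentiableOn ℂ D {z : ℂ | 0 < z.im}) (hC : ∀ z : ℂ, 0 < z.im → ‖D z‖ ≤ C)
    (hlim : ∀ᵐ x : ℝ, x ∈ Ioo (-2:ℝ) 2 →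
      Tendsto (fun y : ℝ => D (↑x + ↑y * I)) (nhdsWithin 0 (Ioi 0)) (nhds 0))
    (z : ℂ) (hz : 0 < z.im) : D z = 0 := by
  have hopen : IsOpen {z : ℂ | 0 < z.im} := isOpen_lt continuous_const Complex.continuous_im
  have hpre : IsPreconnected {z : ℂ | 0 < z.im} :=
    (convex_halfSpace_im_gt 0).isPreconnected
  have hfreq : ∃ᶠ w in nhdsWithin I {I}ᶜ, D w = 0 := by
    have t : Tendsto (fun s : ℝ => (s:ℂ) * I) (nhdsWithin 1 (Ioi 1)) (nhdsWithin I {I}ᶜ) := by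
      apply tendsto_nhdsWithin_of_tendsto_nhds_of_eventually_within
      · have : Continuous (fun s : ℝ => (s:ℂ) * I) := by fun_prop
        have := this.tendsto 1
        simp only [Complex.ofReal_one, one_mul] at this
        exact this.mono_left nhdsWithin_le_nhds
      · filter_upwards [self_mem_nhdsWithin] with s hs h
        have := congrArg Complex.im (show (s:ℂ) * I = I from h)
        simp at this
        exact (ne_of_gt hs) this
    refine t.frequently (Eventually.frequently ?_)
    have : Ioo (1:ℝ) 2 ∈ nhdsWithin (1:ℝ) (Ioi 1) := Ioo_mem_nhdsGT (by norm_num)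
    filter_upwards [this] with s hs
    exact boundary_unique_aux D C hD hC hlim s (by linarith [hs.1]) hs.2
  exact (hD.analyticOnNhd hopen).eqOn_zero_of_preconnected_of_frequently_eq_zero hpre
    (by simp) hfreq hz

/-- The continuation `M` is determined on the lower half plane by `m₋`. -/
lemma reflect_eq (mp mm M : ℂ → ℂ) (hM : DifferentiableOn ℂ M Omega22)
    (hMim : ∀ z ∈ Omega22, 0 < (M z).im) (hMp : ∀ z : ℂ, 0 < z.im → M z = mp z)
    (hmm : DifferentiableOn ℂ mm {z : ℂ | 0 < z.im}) (hmmim : ∀ z : ℂ, 0 < z.im → 0 ≤ (mm z).im)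
    (hr : ReflectionlessOn22 mp mm) (z : ℂ) (hz : 0 < z.im) :
    M (starRingEnd ℂ z) = - starRingEnd ℂ (mm z) := by
  have hopen : IsOpen {z : ℂ | 0 < z.im} := isOpen_lt continuous_const Complex.continuous_im
  have hOm : IsOpen Omega22 := by
    have : Omega22 = {z : ℂ | z.im ≠ 0} ∪ ({z : ℂ | -2 < z.re} ∩ {z : ℂ | z.re < 2}) := by
      ext w; simp [Omega22]
    rw [this]
    refine IsOpen.union ?_ (IsOpen.inter ?_ ?_)
    · exact isOpen_ne_fun Complex.continuous_im continuous_const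
    · exact isOpen_lt continuous_const Complex.continuous_re
    · exact isOpen_lt Complex.continuous_re continuous_const
  have hmem : ∀ w : ℂ, 0 < w.im → starRingEnd ℂ w ∈ Omega22 := fun w hw =>
    Or.inl (by simpa using hw.ne')
  set H : ℂ → ℂ := fun w => - starRingEnd ℂ (M (starRingEnd ℂ w)) with hH
  have hHd : DifferentiableOn ℂ H {z : ℂ | 0 < z.im} := by
    intro w hw
    have h1 : DifferentiableAt ℂ M (starRingEnd ℂ w) :=
      hM.differentiableAt (hOm.mem_nhds (hmem w hw))
    have h2 := h1.conj_conj
    simp only [Complex.conj_conj] at h2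
    exact h2.neg.differentiableWithinAt
  have hHim : ∀ w : ℂ, 0 < w.im → 0 ≤ (H w).im := by
    intro w hw
    simpa [hH] using (hMim _ (hmem w hw)).le
  have hge : ∀ w : ℂ, 0 ≤ w.im → 1 ≤ ‖w + I‖ := by
    intro w hw
    have := (le_abs_self _).trans (Complex.abs_im_le_norm (w + I))
    simp at this
    linarith
  have hne : ∀ w : ℂ, 0 ≤ w.im → w + I ≠ 0 := fun w hw => by
    have := hge w hw
    intro h; rw [h] at this; simp at this; linarith
  set D : ℂ → ℂ := fun w => (mm w + I)⁻¹ - (H w + I)⁻¹ with hDdef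
  have hle : ∀ w : ℂ, 0 ≤ w.im → ‖(w + I)⁻¹‖ ≤ 1 := fun w hw => by
    rw [norm_inv]; exact inv_le_one_of_one_le₀ (hge w hw)
  have hD0 : D z = 0 := by
    apply boundary_unique D 2 _ _ _ z hz
    · exact ((hmm.add_const I).inv (fun w hw => hne _ (hmmim w hw))).sub
        ((hHd.add_const I).inv (fun w hw => hne _ (hHim w hw)))
    · intro w hw
      have h1 := hle _ (hmmim w hw)
      have h2 := hle _ (hHim w hw)
      exact (norm_sub_le _ _).trans (by linarith)
    · filter_upwards [hr] with x hx hx2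
      have h1 := hx hx2
      have hxO : (x:ℂ) ∈ Omega22 := Or.inr (by simpa using hx2)
      have hc : ContinuousAt M x := (hM.differentiableAt (hOm.mem_nhds hxO)).continuousAt
      have t1 : Tendsto (fun y : ℝ => M (x + y * I)) (nhdsWithin 0 (Ioi 0)) (nhds (M x)) := by
        refine hc.tendsto.comp ?_
        have : Continuous (fun y : ℝ => (x:ℂ) + y * I) := by fun_prop
        have := this.tendsto 0
        simp only [Complex.ofReal_zero, zero_mul, add_zero] at this
        exact this.mono_left nhdsWithin_le_nhds
      have t2 : Tendsto (fun y : ℝ => M (x - y * I)) (nhdsWithin 0 (Ioi 0)) (nhds (M x)) := by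
        refine hc.tendsto.comp ?_
        have : Continuous (fun y : ℝ => (x:ℂ) - y * I) := by fun_prop
        have := this.tendsto 0
        simp only [Complex.ofReal_zero, zero_mul, sub_zero] at this
        exact this.mono_left nhdsWithin_le_nhds
      have t3 := h1.add (t2.sub t1)
      simp only [sub_self, add_zero] at t3
      have t4 := t3.norm
      rw [norm_zero] at t4
      refine squeeze_zero_norm' ?_ t4
      filter_upwards [self_mem_nhdsWithin] with y hy
      have hy' : 0 < ((x:ℂ) + y * I).im := by simpa using hy
      set w : ℂ := (x:ℂ) + y * I with hw
      have hcw : starRingEnd ℂ w = (x:ℂ) - y * I := by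
        simp [hw]; ring
      have n1 := hne _ (hmmim w hy')
      have n2 := hne _ (hHim w hy')
      have e : D w = (H w - mm w) * ((mm w + I)⁻¹ * (H w + I)⁻¹) := by
        simp only [hDdef]; field_simp; ring
      have e2 : mp w + starRingEnd ℂ (mm w) + (M (x - y * I) - M w) =
          - starRingEnd ℂ (H w - mm w) := by
        rw [hMp w hy', ← hcw]
        simp [hH]
        ring
      rw [e2, e, norm_neg, RCLike.norm_conj, norm_mul, norm_mul]
      have h1 := hle _ (hmmim w hy')
      have h2 := hle _ (hHim w hy')
      exact mul_le_of_le_one_right (norm_nonneg _) (mul_le_one₀ h1 (norm_nonneg _) h2)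
  have h1 : mm z = H z := by
    have : (mm z + I)⁻¹ = (H z + I)⁻¹ := sub_eq_zero.mp hD0
    exact add_right_cancel (inv_injective this)
  rw [h1]; simp [hH]

lemma stieltjes_lim (σ : Measure ℝ) [IsFiniteMeasure σ] :
    Tendsto (fun Y : ℝ => (Y:ℂ) * ∫ t : ℝ, ((t:ℂ) - Y * I)⁻¹ ∂σ) atTop
      (nhds (I * ((σ Set.univ).toReal : ℂ))) := by
  have h0 : I * ((σ Set.univ).toReal : ℂ) = ∫ t : ℝ, I ∂σ := by
    simp [measureReal_def, mul_comm]
  rw [h0]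
  simp_rw [← integral_const_mul]
  apply MeasureTheory.tendsto_integral_filter_of_dominated_convergence (fun _ => (1:ℝ))
  · filter_upwards [eventually_gt_atTop 0] with Y hY
    apply Measurable.aestronglyMeasurable
    fun_prop
  · filter_upwards [eventually_gt_atTop 0] with Y hY
    refine Eventually.of_forall fun t => ?_
    have h1 := Complex.abs_im_le_norm ((t:ℂ) - Y * I)
    simp [abs_of_pos hY] at h1
    rw [norm_mul, norm_inv, Complex.norm_real, Real.norm_eq_abs, abs_of_pos hY, ← div_eq_mul_inv]
    exact div_le_one_of_le₀ h1 (norm_nonneg _)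
  · exact integrable_const _
  · refine Eventually.of_forall fun t => ?_
    have t1 : Tendsto (fun Y : ℝ => ((Y⁻¹ : ℝ) : ℂ)) atTop (nhds 0) := by
      have := (Complex.continuous_ofReal.tendsto 0).comp tendsto_inv_atTop_zero
      simpa [Function.comp_def] using this
    have t2 : Tendsto (fun Y : ℝ => ((t:ℂ) * ((Y⁻¹ : ℝ) : ℂ) - I)⁻¹) atTop (nhds I) := by
      have := ((t1.const_mul (t:ℂ)).sub_const I).inv₀ (by simp)
      simpa using this
    refine t2.congr' ?_
    filter_upwards [eventually_gt_atTop 0] with Y hY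
    have hY' : (Y:ℂ) ≠ 0 := by exact_mod_cast hY.ne'
    have e : (t:ℂ) - Y * I = Y * ((t:ℂ) * ((Y⁻¹ : ℝ) : ℂ) - I) := by
      push_cast; field_simp
    rw [e, mul_inv, ← mul_assoc, mul_inv_cancel₀ hY', one_mul]

lemma coeff_zero (A : ℝ) (k : ℕ) (hk : k ≠ 0) (E : ℝ → ℝ) (l : ℝ) (hE : Tendsto E atTop (nhds l))
    (h : ∀ Y : ℝ, 1 < Y → Y^k * A + E Y = 0) : A = 0 ∧ l = 0 := by
  have hA : A = 0 := by
    have t : Tendsto (fun Y : ℝ => -(E Y) * (Y^k)⁻¹) atTop (nhds (-l * 0)) :=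
      hE.neg.mul ((tendsto_pow_atTop hk).inv_tendsto_atTop)
    rw [mul_zero] at t
    refine tendsto_nhds_unique (tendsto_const_nhds.congr' ?_) t
    filter_upwards [eventually_gt_atTop 1] with Y hY
    have : Y^k ≠ 0 := by positivity
    have := h Y hY
    field_simp
    linarith
  refine ⟨hA, tendsto_nhds_unique hE (tendsto_const_nhds.congr' ?_)⟩
  filter_upwards [eventually_gt_atTop 1] with Y hY
  have := h Y hY
  rw [hA] at this; linarith

/-- Equations (3.13) and (a0): let `R ≥ 2`, `r ∈ (0,1]`, `r + 1/r = R`, let `J ∈ M_R` and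
let `σ` be the measure on `(-1/r,-r) ∪ (r,1/r)` representing its `F` function via
`F(λ) = -σ₋₁ + (1-σ₋₂)λ + ∫ dσ(t)/(t-λ)`. Then `σ₋₂ = 1 - 1/a₀²`
(equivalently `a₀ = (1-σ₋₂)^{-1/2}`), `b₀ = -σ₋₁/(1-σ₋₂)`, and `σ₀ = (a₋₁² - 1)/a₀²`. -/
theorem statement13 (R r : ℝ) (hR : 2 ≤ R) (hr0 : 0 < r) (hr1 : r ≤ 1)
    (hrR : r + 1/r = R) (a b : ℤ → ℝ) (hJ : MemMR R a b)
    (F : ℂ → ℂ) (hF : IsFFunction a b F)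
    (σ : Measure ℝ) (hfin : IsFiniteMeasure σ)
    (hsupp : σ ((Set.Ioo (-(1/r)) (-r) ∪ Set.Ioo r (1/r))ᶜ) = 0)
    (hrep : ∀ l : ℂ, 0 < l.im →
      F l = (↑(-(∫ t : ℝ, t⁻¹ ∂σ)) : ℂ) + (↑(1 - ∫ t : ℝ, (t^2)⁻¹ ∂σ) : ℂ) * l +
        ∫ t : ℝ, ((t:ℂ) - l)⁻¹ ∂σ) :
    (∫ t : ℝ, (t^2)⁻¹ ∂σ) = 1 - 1/(a 0)^2 ∧
    a 0 = (1 - ∫ t : ℝ, (t^2)⁻¹ ∂σ) ^ (-(1/2) : ℝ) ∧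
    b 0 = -(∫ t : ℝ, t⁻¹ ∂σ) / (1 - ∫ t : ℝ, (t^2)⁻¹ ∂σ) ∧
    (σ Set.univ).toReal = ((a (-1))^2 - 1) / (a 0)^2 := by
  obtain ⟨ha, ⟨T, hT, -⟩, mp', mm, hmp', hmm, hrefl⟩ := hJ
  obtain ⟨mp, M, hmp, hM, hMim, hMp, hFM⟩ := hF
  obtain ⟨g, K, hg, hgim, hgK, hgm⟩ := mminus_formula a b ha T hT
  have hmp_eq : ∀ z : ℂ, 0 < z.im → mp z = mp' z := fun z hz =>
    mplus_unique a b ha T hT mp mp' hmp hmp' z hz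
  have hmf := hgm mm hmm
  have ha0 : 0 < a 0 := ha 0
  have ha0c : (a 0 : ℂ) ≠ 0 := by exact_mod_cast ha0.ne'
  have hmmd : DifferentiableOn ℂ mm {z : ℂ | 0 < z.im} := by
    have : DifferentiableOn ℂ (fun z => (z - b 0 + (a (-1) : ℂ)^2 * g z) / (a 0 : ℂ)^2)
        {z : ℂ | 0 < z.im} :=
      ((differentiableOn_id.sub_const _).add (hg.const_mul _)).div_const _
    exact this.congr (fun z hz => hmf z hz)
  have hmmim : ∀ z : ℂ, 0 < z.im → 0 ≤ (mm z).im := by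
    intro z hz
    rw [hmf z hz]
    have e : (z - b 0 + (a (-1) : ℂ)^2 * g z) / (a 0 : ℂ)^2 =
        (z - b 0 + ((a (-1)^2 : ℝ) : ℂ) * g z) / ((a 0 ^2 : ℝ) : ℂ) := by push_cast; rfl
    rw [e, Complex.div_ofReal_im, Complex.add_im, Complex.im_ofReal_mul, Complex.sub_im,
      Complex.ofReal_im, sub_zero]
    have := hgim z hz
    positivity
  have hkey := reflect_eq mp' mm M hM hMim (fun z hz => (hMp z hz).trans (hmp_eq z hz))
    hmmd hmmim hrefl
  set α : ℝ := -(∫ t : ℝ, t⁻¹ ∂σ) with hα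
  set β : ℝ := 1 - ∫ t : ℝ, (t^2)⁻¹ ∂σ with hβ
  set p : ℝ := 1 / (a 0)^2 with hp
  set E : ℝ → ℂ := fun Y => (Y:ℂ) * (∫ t : ℝ, ((t:ℂ) - Y * I)⁻¹ ∂σ) + I * p +
    p * (a (-1) : ℂ)^2 * ((Y:ℂ) * starRingEnd ℂ (g (((Y - 1/Y : ℝ) : ℂ) * I))) with hE
  have hηpos : ∀ Y : ℝ, 1 < Y → 0 < Y - 1/Y := by
    intro Y hY
    have : 1 / Y < 1 := by rw [div_lt_one (by linarith)]; exact hY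
    linarith
  have heq : ∀ Y : ℝ, 1 < Y →
      (Y:ℂ) * ((α - b 0 * p : ℝ) : ℂ) + (Y:ℂ)^2 * ((β - p : ℝ) : ℂ) * I + E Y = 0 := by
    intro Y hY
    have hYc : (Y:ℂ) ≠ 0 := by
      have : Y ≠ 0 := by linarith
      exact_mod_cast this
    have him : 0 < ((Y:ℂ) * I).im := by simp; linarith
    have hη := hηpos Y hY
    set z : ℂ := ((Y - 1/Y : ℝ) : ℂ) * I with hz
    have hzim : 0 < z.im := by simpa [hz] using hη
    have e1 : F (Y * I) = M (starRingEnd ℂ z) := by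
      rw [hFM _ him]
      congr 1
      simp only [hz, map_mul, Complex.conj_ofReal, Complex.conj_I]
      push_cast
      field_simp
      linear_combination (-1:ℂ) * Complex.I_sq
    have e2 := hkey z hzim
    rw [hmf z hzim] at e2
    have e3 := hrep _ him
    rw [e1, e2] at e3
    simp only [map_div₀, map_add, map_sub, map_mul, map_pow, Complex.conj_ofReal] at e3
    have hzc : starRingEnd ℂ z = -(((Y:ℂ) - 1/Y) * I) := by
      simp [hz]
    rw [hzc] at e3
    have hpc : (p:ℂ) = 1 / (a 0 : ℂ)^2 := by rw [hp]; push_cast; rfl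
    have e3' := congrArg (fun w : ℂ => (Y:ℂ) * w) e3
    simp only [hE]
    rw [← hz]
    push_cast
    rw [div_eq_mul_one_div, ← hpc] at e3'
    have hYY : (Y:ℂ) * (1 / Y) = 1 := by field_simp
    linear_combination -e3' - (p:ℂ) * I * hYY
  have hηt : Tendsto (fun Y : ℝ => Y - 1/Y) atTop atTop := by
    have h1 : Tendsto (fun Y : ℝ => -(1/Y)) atTop (nhds (-0)) := by
      simp only [one_div]; exact tendsto_inv_atTop_zero.neg
    exact tendsto_id.atTop_add h1
  have hgl : Tendsto (fun x : ℝ => ((x:ℂ) * I) * g ((x:ℂ) * I)) atTop (nhds (-1)) := by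
    rw [tendsto_iff_norm_sub_tendsto_zero]
    refine squeeze_zero' (Eventually.of_forall fun _ => norm_nonneg _) ?_
      (tendsto_const_nhds.div_atTop tendsto_id : Tendsto (fun x : ℝ => K / x) atTop (nhds 0))
    filter_upwards [eventually_gt_atTop 0] with x hx
    have := hgK ((x:ℂ) * I) (by simpa using hx)
    simpa [sub_neg_eq_add] using this
  have hratio : Tendsto (fun Y : ℝ => ((Y / (Y - 1/Y) : ℝ) : ℂ)) atTop (nhds 1) := by
    have h1 : Tendsto (fun Y : ℝ => (1 - Y⁻¹ * Y⁻¹)⁻¹) atTop (nhds 1) := by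
      have := ((tendsto_inv_atTop_zero (𝕜 := ℝ)).mul (tendsto_inv_atTop_zero (𝕜 := ℝ))).const_sub 1
      have := this.inv₀ (by norm_num)
      simpa using this
    have h2 : Tendsto (fun Y : ℝ => Y / (Y - 1/Y)) atTop (nhds 1) := by
      refine h1.congr' ?_
      filter_upwards [eventually_gt_atTop 1] with Y hY
      have hY0 : Y ≠ 0 := by linarith
      have e : Y - 1/Y = Y * (1 - Y⁻¹ * Y⁻¹) := by field_simp
      rw [e, ← div_div, div_self hY0, one_div]
    have := (Complex.continuous_ofReal.tendsto 1).comp h2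
    simpa [Function.comp_def] using this
  have hgl2 : Tendsto (fun Y : ℝ => (Y:ℂ) * starRingEnd ℂ (g (((Y - 1/Y : ℝ) : ℂ) * I)))
      atTop (nhds (-I)) := by
    have h1 := (Complex.continuous_conj.tendsto _).comp ((hgl.comp hηt).const_mul (-I))
    have h2 := hratio.mul h1
    have e : (1:ℂ) * starRingEnd ℂ (-I * -1) = -I := by simp
    rw [e] at h2
    refine h2.congr' ?_
    filter_upwards [eventually_gt_atTop 1] with Y hY
    have hη := hηpos Y hY
    have hηc : ((Y - 1/Y : ℝ) : ℂ) ≠ 0 := by exact_mod_cast hη.ne'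
    simp only [Function.comp]
    rw [Complex.ofReal_div]
    generalize Y - 1/Y = η at *
    simp only [map_mul, map_neg, Complex.conj_I, Complex.conj_ofReal]
    field_simp
    linear_combination (-(Y:ℂ) * (starRingEnd ℂ (g ((η:ℂ) * I)))) * Complex.I_sq
  have hEl : Tendsto E atTop
      (nhds (I * ((σ Set.univ).toReal : ℂ) + I * p + p * (a (-1) : ℂ)^2 * (-I))) :=
    ((stieltjes_lim σ).add_const _).add (hgl2.const_mul _)
  have hre := coeff_zero (α - b 0 * p) 1 one_ne_zero (fun Y => (E Y).re) _
    ((Complex.continuous_re.tendsto _).comp hEl) (fun Y hY => by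
      have := congrArg Complex.re (heq Y hY)
      rw [← Complex.ofReal_pow, ← Complex.ofReal_mul, ← Complex.ofReal_mul] at this
      simpa only [Complex.add_re, Complex.re_ofReal_mul, Complex.I_re, mul_zero, add_zero,
        Complex.ofReal_re, Complex.zero_re, pow_one] using this)
  have him := coeff_zero (β - p) 2 two_ne_zero (fun Y => (E Y).im) _
    ((Complex.continuous_im.tendsto _).comp hEl) (fun Y hY => by
      have := congrArg Complex.im (heq Y hY)
      rw [← Complex.ofReal_pow, ← Complex.ofReal_mul, ← Complex.ofReal_mul] at this
      simpa only [Complex.add_im, Complex.im_ofReal_mul, Complex.I_im, mul_one, zero_add,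
        Complex.ofReal_im, Complex.zero_im] using this)
  have hαe : α = b 0 * p := by linarith [hre.1]
  have hβe : β = p := by linarith [him.1]
  have hσe := him.2
  have e5 : I * ((σ Set.univ).toReal : ℂ) + I * p + p * (a (-1) : ℂ)^2 * (-I) =
      (((σ Set.univ).toReal + p - p * (a (-1))^2 : ℝ) : ℂ) * I := by push_cast; ring
  rw [e5, Complex.im_ofReal_mul, Complex.I_im, mul_one] at hσe
  have hp0 : p ≠ 0 := by rw [hp]; positivity
  refine ⟨by linarith, ?_, ?_, ?_⟩
  · rw [hβe, hp, one_div, Real.inv_rpow (by positivity), Real.rpow_neg (by positivity), inv_inv,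
      ← Real.sqrt_eq_rpow, Real.sqrt_sq ha0.le]
  · rw [hβe, hαe]; field_simp
  · have : (σ Set.univ).toReal = p * ((a (-1))^2 - 1) := by linarith
    rw [this, hp]; ring
end
end

section
/- Define m_+ : ℂ⁺ → ℂ by m_+(z) = (1/2)·( √((z−2)/(z+2)) − 1 ), where √ is the principal branch of the square root (note (z−2)/(z+2) ∈ ℂ⁺ for z ∈ ℂ⁺, so this is well defined). Then m_+ is a Herglotz function and m_+(z) = ∫_{−2}^{2} (1/(x − z)) · (1/(2π)) √((2−x)/(2+x)) dx for every z ∈ ℂ⁺. -/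
open MeasureTheory Complex Filter Set

noncomputable section

lemma half_pow_facts (u : ℂ) (hu : 0 < u.im) :
    0 < (u ^ ((1 : ℂ)/2)).re ∧ 0 < (u ^ ((1 : ℂ)/2)).im ∧ (u ^ ((1 : ℂ)/2)) ^ 2 = u := by
  have hu0 : u ≠ 0 := by rintro rfl; simp at hu
  have h1 : 0 ≤ u.arg := Complex.arg_nonneg_iff.2 hu.le
  have h2 : u.arg < Real.pi := by
    refine lt_of_le_of_ne (Complex.arg_le_pi u) ?_
    intro h
    have := (Complex.arg_eq_pi_iff.1 h).2
    linarith
  have h3 : 0 < u.arg := by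
    refine lt_of_le_of_ne h1 ?_
    intro h
    have := (Complex.arg_eq_zero_iff.1 h.symm).2
    linarith
  have hre : (Complex.log u * ((1:ℂ)/2)).re = (Complex.log u).re / 2 := by
    rw [Complex.mul_re]; norm_num; ring
  have him : (Complex.log u * ((1:ℂ)/2)).im = u.arg / 2 := by
    rw [Complex.mul_im, Complex.log_im]; norm_num; ring
  refine ⟨?_, ?_, ?_⟩
  · rw [Complex.cpow_def_of_ne_zero hu0, Complex.exp_re, him]
    exact mul_pos (Real.exp_pos _) (Real.cos_pos_of_mem_Ioo ⟨by linarith, by linarith⟩)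
  · rw [Complex.cpow_def_of_ne_zero hu0, Complex.exp_im, him]
    exact mul_pos (Real.exp_pos _) (Real.sin_pos_of_pos_of_lt_pi (by linarith) (by linarith))
  · rw [← Complex.cpow_nat_mul]; norm_num

lemma quot_im (z : ℂ) (hz : 0 < z.im) : z + 2 ≠ 0 ∧ 0 < ((z - 2) / (z + 2)).im := by
  have h0 : z + 2 ≠ 0 := by
    intro h
    have := congrArg Complex.im h
    simp at this
    linarith
  refine ⟨h0, ?_⟩
  have hn : 0 < Complex.normSq (z + 2) := Complex.normSq_pos.2 h0
  have : ((z - 2) / (z + 2)).im = 4 * z.im / Complex.normSq (z + 2) := by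
    rw [Complex.div_im]; simp; field_simp; ring
  rw [this]; positivity

/-- The building block of the antiderivative. -/
def auxF (w : ℂ) (x : ℝ) : ℂ :=
  (Complex.log (w * (Real.sqrt (2 + x) : ℝ) + I * (Real.sqrt (2 - x) : ℝ))
    - Complex.log (w * (Real.sqrt (2 + x) : ℝ) - I * (Real.sqrt (2 - x) : ℝ))) / (2 * I)

lemma aux_slit (w : ℂ) (hw : 0 < w.re) (x : ℝ) (hx : x ∈ Icc (-2:ℝ) 2) :
    (w * (Real.sqrt (2 + x) : ℝ) + I * (Real.sqrt (2 - x) : ℝ)) ∈ slitPlane ∧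
    (w * (Real.sqrt (2 + x) : ℝ) - I * (Real.sqrt (2 - x) : ℝ)) ∈ slitPlane := by
  rcases eq_or_lt_of_le hx.1 with h | h
  · subst h
    have : 0 < Real.sqrt (2 - -2) := Real.sqrt_pos.2 (by norm_num)
    constructor <;> right <;> simp [this.ne']
  · have : 0 < Real.sqrt (2 + x) := Real.sqrt_pos.2 (by linarith)
    constructor <;> left <;> simp <;> positivity

lemma auxF_cont (w : ℂ) (hw : 0 < w.re) : ContinuousOn (auxF w) (Icc (-2) 2) := by
  unfold auxF
  refine ContinuousOn.div_const (ContinuousOn.sub ?_ ?_) _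
  · refine ContinuousOn.clog ?_ fun x hx => (aux_slit w hw x hx).1
    fun_prop
  · refine ContinuousOn.clog ?_ fun x hx => (aux_slit w hw x hx).2
    fun_prop

lemma auxF_two (w : ℂ) : auxF w 2 = 0 := by simp [auxF]

lemma auxF_neg_two (w : ℂ) : auxF w (-2) = Real.pi / 2 := by
  have h4 : Real.sqrt (2 - -2) = 2 := by
    rw [show (2:ℝ) - -2 = 2 ^ 2 by norm_num]; exact Real.sqrt_sq (by norm_num)
  have e1 : Complex.log (I * ((2:ℝ):ℂ)) = Real.log 2 + Real.pi / 2 * I := by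
    rw [mul_comm, Complex.log_ofReal_mul (by norm_num) I_ne_zero, Complex.log_I]
  have e2 : Complex.log (-(I * ((2:ℝ):ℂ))) = Real.log 2 - Real.pi / 2 * I := by
    rw [show -(I * ((2:ℝ):ℂ)) = ((2:ℝ):ℂ) * (-I) by ring,
      Complex.log_ofReal_mul (by norm_num) (neg_ne_zero.2 I_ne_zero), Complex.log_neg_I]
    ring
  unfold auxF
  rw [h4]
  have h0 : Real.sqrt (2 + -2) = 0 := by norm_num
  rw [h0, Complex.ofReal_zero, mul_zero, zero_add, zero_sub, e1, e2]
  have := I_ne_zero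
  field_simp
  ring

lemma auxF_deriv (w : ℂ) (hw : 0 < w.re) (x : ℝ) (hx : x ∈ Ioo (-2:ℝ) 2) :
    HasDerivAt (auxF w) (-2 * w / ((Real.sqrt (2 + x) : ℝ) * (Real.sqrt (2 - x) : ℝ) *
      (w ^ 2 * (2 + x) + (2 - x)))) x := by
  obtain ⟨s1, s2⟩ := aux_slit w hw x ⟨hx.1.le, hx.2.le⟩
  have ha : 0 < 2 + x := by linarith [hx.1]
  have hb : 0 < 2 - x := by linarith [hx.2]
  have da : HasDerivAt (fun x : ℝ => ((Real.sqrt (2 + x) : ℝ) : ℂ))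
      ((1 / (2 * Real.sqrt (2 + x)) : ℝ) : ℂ) x :=
    (((hasDerivAt_id x).const_add 2).sqrt ha.ne').ofReal_comp
  have db : HasDerivAt (fun x : ℝ => ((Real.sqrt (2 - x) : ℝ) : ℂ))
      ((-1 / (2 * Real.sqrt (2 - x)) : ℝ) : ℂ) x :=
    (((hasDerivAt_id x).const_sub 2).sqrt hb.ne').ofReal_comp
  have d1 := ((da.const_mul w).add (db.const_mul I)).clog_real s1
  have d2 := ((da.const_mul w).sub (db.const_mul I)).clog_real s2
  have d := (d1.sub d2).div_const (2 * I)
  refine HasDerivAt.congr_deriv d ?_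
  have n1 := slitPlane_ne_zero s1
  have n2 := slitPlane_ne_zero s2
  have a0 : ((Real.sqrt (2 + x) : ℝ) : ℂ) ≠ 0 := by
    exact_mod_cast (Real.sqrt_pos.2 ha).ne'
  have b0 : ((Real.sqrt (2 - x) : ℝ) : ℂ) ≠ 0 := by
    exact_mod_cast (Real.sqrt_pos.2 hb).ne'
  have a2 : ((Real.sqrt (2 + x) : ℝ) : ℂ) ^ 2 = 2 + x := by
    have := Real.sq_sqrt ha.le
    exact_mod_cast this
  have b2 : ((Real.sqrt (2 - x) : ℝ) : ℂ) ^ 2 = 2 - x := by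
    have := Real.sq_sqrt hb.le
    exact_mod_cast this
  have s4 : ((Real.sqrt (2 + x) : ℝ) : ℂ) ^ 2 + ((Real.sqrt (2 - x) : ℝ) : ℂ) ^ 2 = 4 := by
    rw [a2, b2]; ring
  simp only [Pi.add_apply, Pi.sub_apply] 
  push_cast
  rw [← a2, ← b2]
  generalize ((Real.sqrt (2 + x) : ℝ) : ℂ) = a at *
  generalize ((Real.sqrt (2 - x) : ℝ) : ℂ) = b at *
  have hI := I_ne_zero
  have n3 : w ^ 2 * a ^ 2 + b ^ 2 = (w * a + I * b) * (w * a - I * b) := by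
    linear_combination (b ^ 2) * I_sq
  rw [n3, div_sub_div _ _ n1 n2, div_div, div_eq_div_iff
    (mul_ne_zero (mul_ne_zero n1 n2) (mul_ne_zero two_ne_zero hI))
    (mul_ne_zero (mul_ne_zero a0 b0) (mul_ne_zero n1 n2))]
  field_simp
  linear_combination (-2 * w * I) * s4

theorem statement19 (m : ℂ → ℂ)
    (hm : ∀ z : ℂ, 0 < z.im →
      m z = (1/2 : ℂ) * (((z - 2) / (z + 2)) ^ ((1 : ℂ)/2) - 1)) :
    IsHerglotz m ∧
    ∀ z : ℂ, 0 < z.im →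
      m z = ∫ x in Set.Ioo (-2:ℝ) 2,
        ((x : ℂ) - z)⁻¹ * ((((2 * Real.pi)⁻¹ * Real.sqrt ((2 - x) / (2 + x)) : ℝ)) : ℂ) := by
  refine ⟨⟨?_, ?_⟩, ?_⟩
  · refine DifferentiableOn.congr (f := fun z : ℂ =>
      (1/2 : ℂ) * (((z - 2) / (z + 2)) ^ ((1 : ℂ)/2) - 1)) ?_ (fun z hz => hm z hz)
    intro z hz
    obtain ⟨h0, h1⟩ := quot_im z hz
    have hq : DifferentiableAt ℂ (fun z : ℂ => (z - 2) / (z + 2)) z :=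
      DifferentiableAt.div (by fun_prop) (by fun_prop) h0
    exact (((hq.cpow (differentiableAt_const _) (Or.inr h1.ne')).sub_const 1).const_mul
      _).differentiableWithinAt
  · intro z hz
    obtain ⟨h0, h1⟩ := quot_im z hz
    have := (half_pow_facts _ h1).2.1
    rw [hm z hz, Complex.mul_im]
    norm_num
    simpa using this
  · intro z hz
    obtain ⟨h0, h1⟩ := quot_im z hz
    obtain ⟨wre, -, wsq⟩ := half_pow_facts _ h1
    rw [hm z hz]
    set w := ((z - 2) / (z + 2)) ^ ((1 : ℂ)/2) with hw
    have hpi : (Real.pi : ℂ) ≠ 0 := by exact_mod_cast Real.pi_ne_zero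
    have hxz : ∀ x : ℝ, (x : ℂ) - z ≠ 0 := by
      intro x h
      have := congrArg Complex.im h
      simp at this
      linarith
    rw [← integral_Ioc_eq_integral_Ioo, ← intervalIntegral.integral_of_le (by norm_num)]
    have key := intervalIntegral.integral_eq_sub_of_hasDerivAt_of_le (a := (-2:ℝ)) (b := 2)
      (f := fun x => (auxF 1 x - w * auxF w x) / Real.pi)
      (f' := fun x : ℝ => ((x : ℂ) - z)⁻¹ *
        ((((2 * Real.pi)⁻¹ * Real.sqrt ((2 - x) / (2 + x)) : ℝ)) : ℂ))
      (by norm_num)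
      (((auxF_cont 1 (by simp)).sub (continuousOn_const.mul (auxF_cont w wre))).div_const _)
      ?_ ?_
    · rw [key]
      simp only [auxF_two, auxF_neg_two]
      field_simp
      ring
    · intro x hx
      have d := ((auxF_deriv 1 (by simp) x hx).sub
        ((auxF_deriv w wre x hx).const_mul w)).div_const (Real.pi : ℂ)
      refine HasDerivAt.congr_deriv d ?_
      have ha : 0 < 2 + x := by linarith [hx.1]
      have hb : 0 < 2 - x := by linarith [hx.2]
      have a0 : ((Real.sqrt (2 + x) : ℝ) : ℂ) ≠ 0 := by
        exact_mod_cast (Real.sqrt_pos.2 ha).ne'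
      have b0 : ((Real.sqrt (2 - x) : ℝ) : ℂ) ≠ 0 := by
        exact_mod_cast (Real.sqrt_pos.2 hb).ne'
      have b2 : ((Real.sqrt (2 - x) : ℝ) : ℂ) ^ 2 = 2 - x := by
        have := Real.sq_sqrt hb.le
        exact_mod_cast this
      have e : w ^ 2 * (2 + x) + (2 - x) = -4 * (x - z) / (z + 2) := by
        rw [wsq]; field_simp; ring
      have e1 : (1:ℂ) ^ 2 * (2 + x) + (2 - x) = 4 := by ring
      have e2 : w * (-2 * w / ((Real.sqrt (2 + x) : ℝ) * (Real.sqrt (2 - x) : ℝ) *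
          (w ^ 2 * (2 + x) + (2 - x)))) = -2 * ((z - 2) / (z + 2)) /
          ((Real.sqrt (2 + x) : ℝ) * (Real.sqrt (2 - x) : ℝ) * (-4 * (x - z) / (z + 2))) := by
        rw [e, ← wsq]; ring
      rw [e2, e1, Real.sqrt_div hb.le]
      push_cast
      have := hxz x
      generalize ((Real.sqrt (2 + x) : ℝ) : ℂ) = a at *
      generalize ((Real.sqrt (2 - x) : ℝ) : ℂ) = b at *
      field_simp
      rw [b2]
      ring
    · have hr : IntervalIntegrable (fun x : ℝ => (x + 2) ^ (-(1/2) : ℝ)) volume (-2) 2 := by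
        have := (intervalIntegral.intervalIntegrable_rpow' (a := 0) (b := 4)
          (r := -(1/2)) (by norm_num)).comp_add_right 2
        norm_num at this ⊢
        exact this
      have hc : ContinuousOn (fun x : ℝ => ((x : ℂ) - z)⁻¹ *
          (((2 * Real.pi)⁻¹ * Real.sqrt (2 - x) : ℝ) : ℂ)) (uIcc (-2) 2) := by
        refine ContinuousOn.mul (ContinuousOn.inv₀ (by fun_prop) fun x _ => hxz x) (by fun_prop)
      have hr2 : IntervalIntegrable (fun x : ℝ => (((x + 2) ^ (-(1/2) : ℝ) : ℝ) : ℂ)) volume (-2) 2 :=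
        ⟨hr.1.ofReal, hr.2.ofReal⟩
      refine (IntervalIntegrable.continuousOn_mul hr2 hc).congr ?_
      intro x hx
      rw [uIoc_of_le (by norm_num)] at hx
      have ha : 0 < x + 2 := by linarith [hx.1]
      have : Real.sqrt ((2 - x) / (2 + x)) = Real.sqrt (2 - x) * (x + 2) ^ (-(1/2) : ℝ) := by
        rw [Real.sqrt_div (by linarith [hx.2]), Real.rpow_neg ha.le, ← Real.sqrt_eq_rpow,
          add_comm x 2, div_eq_mul_inv]
      simp only [this]
      push_cast
      ring
end
end
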